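/- arXiv:1410.4344 — 4 statements merged into one kernel-verified Lean document; each statement's English description precedes it below -/
import Mathlib

section
/- Let γ, σ > 0 and let p : (0,∞) → [0,1] be measurable with √t · p(t) → 1/√(2πσ²) as t → ∞. Then for every real C < log(√(2π)·γ/σ) there exists K > e such that the function f defined by f(t) = (1/2)log t − log log t + C for t ≥ K and f(t) = −1 for 0 ≤ t < K satisfies the strict subsolution inequality f(t) < ∫₀ᵗ γ p(t−s) exp(−f(s)) ds for all t ≥ 0. -/
open Real

open MeasureTheory in
theorem ae_mem_Icc_reflect {p : ℝ → ℝ} (hp : ∀ t > (0 : ℝ), p t ∈ Set.Icc (0 : ℝ) 1) (t : ℝ) :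
    ∀ᵐ s ∂volume.restrict (Set.Ioc 0 t), p (t - s) ∈ Set.Icc (0 : ℝ) 1 := by
  rw [ae_restrict_iff' measurableSet_Ioc]
  filter_upwards [Measure.ae_ne volume t] with s hs hst
  exact hp _ (sub_pos.mpr (lt_of_le_of_ne hst.2 hs))

open MeasureTheory in
theorem intervalIntegrable_reflect_mul {p g : ℝ → ℝ} (hp_meas : Measurable p)
    (hp : ∀ t > (0 : ℝ), p t ∈ Set.Icc (0 : ℝ) 1) (hg_meas : Measurable g)
    (hg_nonneg : ∀ s, 0 ≤ g s) {B : ℝ} (hgB : ∀ s, g s ≤ B) {γ : ℝ} {t : ℝ} (ht : 0 ≤ t) :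
    IntervalIntegrable (fun s => γ * p (t - s) * g s) volume 0 t := by
  rw [intervalIntegrable_iff_integrableOn_Ioc_of_le ht]
  refine Integrable.mono' (g := fun _ => |γ| * B) (integrable_const _)
    (by fun_prop) ?_
  filter_upwards [ae_mem_Icc_reflect hp t] with s hs
  rw [norm_mul, norm_mul, Real.norm_eq_abs, Real.norm_eq_abs, Real.norm_eq_abs,
    abs_of_nonneg hs.1, abs_of_nonneg (hg_nonneg s)]
  refine mul_le_mul ?_ (hgB s) (hg_nonneg s) (abs_nonneg γ)
  exact mul_le_of_le_one_right (abs_nonneg γ) hs.2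

theorem hasDerivAt_arcsin_two_mul_div_sub_one {s t : ℝ} (hs : 0 < s) (hst : s < t) :
    HasDerivAt (fun s => arcsin (2 * s / t - 1)) (1 / (√s * √(t - s))) s := by
  have ht : 0 < t := hs.trans hst
  have hv : 0 < s / t := div_pos hs ht
  have hv' : s / t < 1 := (div_lt_one ht).mpr hst
  have hx : 2 * s / t - 1 = 2 * (s / t) - 1 := by ring
  have hlin : HasDerivAt (fun s : ℝ => 2 * s / t - 1) (2 * 1 / t) s :=
    (((hasDerivAt_id s).const_mul 2).div_const t).sub_const 1
  have h := (hasDerivAt_arcsin (x := 2 * s / t - 1) (by rw [hx]; linarith)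
    (by rw [hx]; linarith)).comp s hlin
  refine h.congr_deriv ?_
  have hsq : 1 - (2 * s / t - 1) ^ 2 = (2 / t) ^ 2 * (s * (t - s)) := by
    field_simp
    ring
  have hpos : 0 < √s * √(t - s) := mul_pos (sqrt_pos.mpr hs) (sqrt_pos.mpr (sub_pos.mpr hst))
  rw [hsq, sqrt_mul (by positivity), sqrt_sq (by positivity), sqrt_mul hs.le]
  field_simp

theorem continuousOn_one_div_sqrt_mul_sqrt {a b t : ℝ} (ha : 0 < a) (hb : b < t) :
    ContinuousOn (fun s => 1 / (√s * √(t - s))) (Set.Icc a b) := by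
  refine ContinuousOn.div (by fun_prop) (by fun_prop) fun s hs => ?_
  exact (mul_pos (sqrt_pos.mpr (ha.trans_le hs.1))
    (sqrt_pos.mpr (sub_pos.mpr (hs.2.trans_lt hb)))).ne'

theorem integral_one_div_sqrt_mul_sqrt {a t : ℝ} (ha : 0 < a) (ha' : a ≤ 1 / 2) (ht : 0 < t) :
    ∫ s in (a * t)..((1 - a) * t), 1 / (√s * √(t - s)) = 2 * arcsin (1 - 2 * a) := by
  have hle : a * t ≤ (1 - a) * t := by nlinarith
  have hlt : (1 - a) * t < t := by nlinarith
  have hat : 0 < a * t := mul_pos ha ht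
  rw [intervalIntegral.integral_eq_sub_of_hasDerivAt (f := fun s => arcsin (2 * s / t - 1))]
  · have h1 : 2 * ((1 - a) * t) / t - 1 = 1 - 2 * a := by field_simp; ring
    have h2 : 2 * (a * t) / t - 1 = -(1 - 2 * a) := by field_simp; ring
    rw [h1, h2, arcsin_neg]
    ring
  · intro s hs
    rw [Set.uIcc_of_le hle] at hs
    exact hasDerivAt_arcsin_two_mul_div_sub_one (hat.trans_le hs.1) (hs.2.trans_lt hlt)
  · apply ContinuousOn.intervalIntegrable
    rw [Set.uIcc_of_le hle]
    exact continuousOn_one_div_sqrt_mul_sqrt hat hlt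

theorem log_le_half {y : ℝ} (hy : 0 < y) : log y ≤ y / 2 := by
  have h := log_le_sub_one_of_pos (half_pos hy)
  rw [log_div hy.ne' two_ne_zero] at h
  linarith [log_two_lt_d9]

theorem exp_neg_half_log_sub_log_log {s : ℝ} (hs : 1 < s) (C : ℝ) :
    exp (-((1 / 2) * log s - log (log s) + C)) = exp (-C) * log s / √s := by
  have hs0 : 0 < s := one_pos.trans hs
  have : -((1 / 2) * log s - log (log s) + C) = -C + log (log s) - log √s := by
    rw [log_sqrt hs0.le]; ring
  rw [this, exp_sub, exp_add, exp_log (log_pos hs), exp_log (sqrt_pos.mpr hs0)]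

theorem tendsto_half_log_sub_log_log_add (C : ℝ) :
    Filter.Tendsto (fun s => (1 / 2) * log s - log (log s) + C) Filter.atTop Filter.atTop := by
  have h : Filter.Tendsto (fun y : ℝ => (1 / 2) * y - log y + C) Filter.atTop Filter.atTop := by
    refine Filter.tendsto_atTop_add_const_right _ _ ?_
    have ho := (isLittleO_log_id_atTop.bound (show (0 : ℝ) < 1 / 4 by norm_num))
    refine Filter.tendsto_atTop_mono' _ ?_
      (Filter.tendsto_id.const_mul_atTop (show (0 : ℝ) < 1 / 4 by norm_num))
    filter_upwards [ho, Filter.eventually_ge_atTop 0] with y hy hy0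
    simp only [id, norm_eq_abs, abs_of_nonneg hy0] at hy ⊢
    linarith [le_abs_self (log y)]
  exact h.comp tendsto_log_atTop

/-- The Beta integral `∫₀¹ dv / √(v(1-v)) = π`, truncated to `[a, 1-a]`, still beats the constant. -/
theorem exists_truncation {γ σ C : ℝ} (hγ : 0 < γ) (hσ : 0 < σ)
    (hC : C < log (√(2 * π) * γ / σ)) :
    ∃ a : ℝ, 0 < a ∧ a < 1 / 2 ∧ a < 1 / √(2 * π * σ ^ 2) ∧
      1 / 2 < γ * exp (-C) * (1 / √(2 * π * σ ^ 2) - a) * (2 * arcsin (1 - 2 * a)) := by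
  have hL : 0 < 1 / √(2 * π * σ ^ 2) := by positivity
  have hcont : Continuous fun a : ℝ =>
      γ * exp (-C) * (1 / √(2 * π * σ ^ 2) - a) * (2 * arcsin (1 - 2 * a)) := by
    have := continuous_arcsin
    fun_prop
  have h0 : 1 / 2 < γ * exp (-C) * (1 / √(2 * π * σ ^ 2) - 0) *
      (2 * arcsin (1 - 2 * 0)) := by
    have hpi : √(2 * π) * √(2 * π) = 2 * π := mul_self_sqrt (by positivity)
    have hr : 0 < √(2 * π) := by positivity
    have hexp : exp C < √(2 * π) * γ / σ := (lt_log_iff_exp_lt (by positivity)).mp hC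
    rw [sub_zero, mul_zero, sub_zero, arcsin_one, sqrt_mul (by positivity), sqrt_sq hσ.le,
      exp_neg]
    have heq : γ * (exp C)⁻¹ * (1 / (√(2 * π) * σ)) * (2 * (π / 2)) =
        (√(2 * π) * γ / σ) / exp C / 2 := by
      field_simp
      linear_combination -hpi
    rw [heq]
    have := (one_lt_div (exp_pos C)).mpr hexp
    linarith
  have hev : ∀ᶠ a in nhds (0 : ℝ), a < 1 / 2 ∧ a < 1 / √(2 * π * σ ^ 2) ∧
      1 / 2 < γ * exp (-C) * (1 / √(2 * π * σ ^ 2) - a) * (2 * arcsin (1 - 2 * a)) :=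
    (eventually_lt_nhds (by norm_num)).and
      ((eventually_lt_nhds hL).and (hcont.continuousAt.eventually_const_lt h0))
  obtain ⟨a, ha, ha0⟩ := ((hev.filter_mono nhdsWithin_le_nhds).and
    (self_mem_nhdsWithin : Set.Ioi (0 : ℝ) ∈ nhdsWithin 0 (Set.Ioi 0))).exists
  exact ⟨a, ha0, ha⟩

/-- Existence of a strict subsolution `f(t) = (1/2)log t − log log t + C` (for `t ≥ K`,
and `−1` before `K`) to the functional equation `f(t) = ∫₀ᵗ γ p(t−s) e^{−f(s)} ds`,
for any `C < log(√(2π)γ/σ)`, given the local CLT asymptotics `p(t) ∼ (2πσ²t)^{−1/2}`. -/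
theorem strict_subsolution_exists
    (γ σ : ℝ) (hγ : 0 < γ) (hσ : 0 < σ)
    (p : ℝ → ℝ) (hp_meas : Measurable p)
    (hp_range : ∀ t > (0 : ℝ), p t ∈ Set.Icc (0 : ℝ) 1)
    (hp_clt : Filter.Tendsto (fun t => Real.sqrt t * p t) Filter.atTop
      (nhds (1 / Real.sqrt (2 * π * σ ^ 2))))
    (C : ℝ) (hC : C < Real.log (Real.sqrt (2 * π) * γ / σ)) :
    ∃ K > Real.exp 1,
      ∀ t ≥ (0 : ℝ),
        (if K ≤ t then (1 / 2) * Real.log t - Real.log (Real.log t) + C else -1)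
          < ∫ s in (0 : ℝ)..t, γ * p (t - s) *
              Real.exp (-(if K ≤ s then (1 / 2) * Real.log s - Real.log (Real.log s) + C
                else -1)) := by
  obtain ⟨a, ha0, ha2, haL, hbeta⟩ := exists_truncation hγ hσ hC
  set m := 1 / √(2 * π * σ ^ 2) - a
  have hm0 : 0 < m := sub_pos.mpr haL
  obtain ⟨T, hT⟩ := Filter.eventually_atTop.mp
    (hp_clt.eventually_const_lt (show m < _ by linarith))
  obtain ⟨S, hS⟩ := Filter.eventually_atTop.mp
    ((tendsto_half_log_sub_log_log_add C).eventually_ge_atTop (-1))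
  have hlog := tendsto_log_atTop
  obtain ⟨R, hR⟩ := Filter.eventually_atTop.mp
    (((hlog.comp hlog).eventually_gt_atTop (C - log a / 2)).and
      (hlog.eventually_ge_atTop (-log a)))
  have hat : Filter.Tendsto (fun t : ℝ => a * t) Filter.atTop Filter.atTop :=
    Filter.tendsto_id.const_mul_atTop ha0
  obtain ⟨Q, hQ⟩ := Filter.eventually_atTop.mp
    ((hat.eventually_ge_atTop T).and ((hat.eventually_ge_atTop S).and
      (hat.eventually_gt_atTop 1)))
  refine ⟨max (exp 1 + 1) (max R Q), lt_max_of_lt_left (lt_add_one _), fun t ht => ?_⟩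
  set K := max (exp 1 + 1) (max R Q)
  have hK1 : 1 < K := (lt_add_of_pos_left 1 (exp_pos 1)).trans_le (le_max_left _ _)
  set f : ℝ → ℝ := fun s => if K ≤ s then (1 / 2) * log s - log (log s) + C else -1 with hf
  have hf_meas : Measurable f :=
    Measurable.ite measurableSet_Ici (by fun_prop) measurable_const
  have hf_bound : ∀ s, exp (-f s) ≤ exp (1 + |C|) := by
    intro s
    rw [exp_le_exp]
    simp only [hf]
    split_ifs with h
    · linarith [log_le_half (log_pos (hK1.trans_le h)), neg_abs_le C]
    · linarith [abs_nonneg C]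
  have hint : IntervalIntegrable (fun s => γ * p (t - s) * exp (-f s)) MeasureTheory.volume 0 t :=
    intervalIntegrable_reflect_mul hp_meas hp_range (by fun_prop) (fun s => (exp_pos _).le)
      hf_bound ht
  have hnonneg : 0 ≤ᵐ[MeasureTheory.volume.restrict (Set.Ioc 0 t)]
      fun s => γ * p (t - s) * exp (-f s) := by
    filter_upwards [ae_mem_Icc_reflect hp_range t] with s hs
    exact mul_nonneg (mul_nonneg hγ.le hs.1) (exp_pos _).le
  change f t < ∫ s in (0 : ℝ)..t, γ * p (t - s) * exp (-f s)
  by_cases hKt : K ≤ t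
  swap
  · have : f t = -1 := if_neg hKt
    rw [this]
    exact neg_one_lt_zero.trans_le
      (intervalIntegral.integral_nonneg_of_ae_restrict ht
        (by rwa [MeasureTheory.Measure.restrict_congr_set MeasureTheory.Ioc_ae_eq_Icc] at hnonneg))
  have ht0 : 0 < t := one_pos.trans (hK1.trans_le hKt)
  obtain ⟨hR1, hR2⟩ := hR t (((le_max_left R Q).trans (le_max_right _ _)).trans hKt)
  obtain ⟨hQT, hQS, hQ1⟩ := hQ t (((le_max_right R Q).trans (le_max_right _ _)).trans hKt)
  have hle : a * t ≤ (1 - a) * t := by nlinarith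
  have hlt : (1 - a) * t < t := by nlinarith
  have hl : 0 ≤ log t + log a := by linarith
  have hmono : ∫ s in (a * t)..((1 - a) * t),
        γ * exp (-C) * m * (log t + log a) * (1 / (√s * √(t - s))) ≤
      ∫ s in (a * t)..((1 - a) * t), γ * p (t - s) * exp (-f s) := by
    refine intervalIntegral.integral_mono_on hle ?_ ?_ fun s hs => ?_
    · apply ContinuousOn.intervalIntegrable
      rw [Set.uIcc_of_le hle]
      exact (continuousOn_one_div_sqrt_mul_sqrt (one_pos.trans hQ1) hlt).const_mul _
    · refine hint.mono_set ?_
      rw [Set.uIcc_of_le hle, Set.uIcc_of_le ht]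
      exact Set.Icc_subset_Icc (by linarith) hlt.le
    · have hs1 : 1 < s := hQ1.trans_le hs.1
      have hs0 : 0 < s := one_pos.trans hs1
      have hts : a * t ≤ t - s := by linarith [hs.2]
      have hts0 : 0 < √(t - s) := sqrt_pos.mpr (by linarith)
      have hss0 : 0 < √s := sqrt_pos.mpr hs0
      have hpm : m / √(t - s) ≤ p (t - s) := by
        rw [div_le_iff₀' hts0]
        exact (hT _ (hQT.trans hts)).le
      have hfs : f s ≤ (1 / 2) * log s - log (log s) + C := by
        simp only [hf]
        split_ifs
        · exact le_rfl
        · exact hS s (hQS.trans hs.1)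
      have hexp : exp (-C) * (log t + log a) / √s ≤ exp (-f s) := by
        refine le_trans ?_ (exp_le_exp.mpr (neg_le_neg hfs))
        rw [exp_neg_half_log_sub_log_log hs1]
        have : log t + log a ≤ log s := by
          rw [← log_mul ht0.ne' ha0.ne', mul_comm]
          exact log_le_log (one_pos.trans hQ1) hs.1
        gcongr
      calc γ * exp (-C) * m * (log t + log a) * (1 / (√s * √(t - s)))
          = γ * (m / √(t - s)) * (exp (-C) * (log t + log a) / √s) := by
            field_simp
        _ ≤ γ * p (t - s) * exp (-f s) := by
            have : 0 ≤ p (t - s) := le_trans (by positivity) hpm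
            gcongr
  have hext := intervalIntegral.integral_mono_interval (one_pos.trans hQ1).le hle hlt.le
    hnonneg hint
  rw [intervalIntegral.integral_const_mul,
    integral_one_div_sqrt_mul_sqrt ha0 ha2.le ht0] at hmono
  have hft : f t = (1 / 2) * log t - log (log t) + C := if_pos hKt
  simp only [Function.comp_apply] at hR1
  nlinarith [mul_le_mul_of_nonneg_right hbeta.le hl]
end

section
/- Let a : ℤ → ℝ satisfy a(z) ≥ 0, ∑_z a(z) = 1, ∑_z z·a(z) = 0, σ² := ∑_z z²·a(z) ∈ (0,∞), and suppose the support of a generates ℤ as a group. Define the convolution powers a^{⋆0} = δ₀, a^{⋆(n+1)}(x) = ∑_y a(y)·a^{⋆n}(x−y), and the continuous-time heat kernel p_x(t) = ∑_{n≥0} e^{−t} tⁿ/n! · a^{⋆n}(x). Let γ, α > 0 and suppose f : [0,∞) → [0,∞) is continuous and satisfies f(t) = γ ∫₀ᵗ p₀(t−s) exp(−α f(s)) ds for all t ≥ 0. Then: (i) f is nondecreasing; (ii) f(t) − (1/α)·[(1/2)log t − log log t + log(√(2π)·γα/σ)] → 0 as t → ∞; (iii) γ ∫₀ᵗ exp(−α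 f(s)) ds, divided by (σ/α)·√(2/π)·√t·log t, converges to 1 as t → ∞. -/
open Real

/-- Convolution powers of a jump kernel on ℤ: `convPow a 0 = δ₀`,
`convPow a (n+1) (x) = ∑_y a(y) · convPow a n (x − y)`. -/
noncomputable def convPow (a : ℤ → ℝ) : ℕ → ℤ → ℝ
  | 0 => fun x => if x = 0 then 1 else 0
  | n + 1 => fun x => ∑' y : ℤ, a y * convPow a n (x - y)

/-- Continuous-time heat kernel `p_x(t) = ∑_{n≥0} e^{−t} tⁿ/n! a^{⋆n}(x)`. -/
noncomputable def heatKernel (a : ℤ → ℝ) (x : ℤ) (t : ℝ) : ℝ :=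
  ∑' n : ℕ, Real.exp (-t) * t ^ n / (n.factorial : ℝ) * convPow a n x

section LatticeFourier

open Filter Topology MeasureTheory

variable {a : ℤ → ℝ}

lemma convPow_nonneg (ha : ∀ z, 0 ≤ a z) (n : ℕ) (x : ℤ) : 0 ≤ convPow a n x := by
  induction n generalizing x with
  | zero => simp only [convPow]; split_ifs <;> norm_num
  | succ n ih => exact tsum_nonneg fun y => mul_nonneg (ha y) (ih _)

lemma convPow_le_one (ha : ∀ z, 0 ≤ a z) (hs : HasSum a 1) (n : ℕ) (x : ℤ) :
    convPow a n x ≤ 1 := by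
  induction n generalizing x with
  | zero => simp only [convPow]; split_ifs <;> norm_num
  | succ n ih =>
    have h (y : ℤ) : a y * convPow a n (x - y) ≤ a y :=
      mul_le_of_le_one_right (ha y) (ih _)
    have hsum : Summable fun y => a y * convPow a n (x - y) :=
      hs.summable.of_nonneg_of_le (fun y => mul_nonneg (ha y) (convPow_nonneg ha _ _)) h
    exact (hsum.tsum_le_tsum h hs.summable).trans_eq hs.tsum_eq

lemma summable_mul_convPow (ha : ∀ z, 0 ≤ a z) (hs : HasSum a 1) (n : ℕ) (x : ℤ) :
    Summable fun y => a y * convPow a n (x - y) :=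
  hs.summable.of_nonneg_of_le (fun y => mul_nonneg (ha y) (convPow_nonneg ha _ _))
    fun y => mul_le_of_le_one_right (ha y) (convPow_le_one ha hs _ _)

/-- The characteristic function of a jump kernel on `ℤ`. -/
noncomputable def latticeCharFun (a : ℤ → ℝ) (θ : ℝ) : ℂ :=
  ∑' z : ℤ, (a z : ℂ) * Complex.exp ((z * θ : ℝ) * Complex.I)

lemma norm_latticeCharFun_term (ha : ∀ z, 0 ≤ a z) (z : ℤ) (θ : ℝ) :
    ‖(a z : ℂ) * Complex.exp ((z * θ : ℝ) * Complex.I)‖ = a z := by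
  rw [norm_mul, Complex.norm_exp_ofReal_mul_I, mul_one, Complex.norm_real, Real.norm_eq_abs,
    abs_of_nonneg (ha z)]

lemma hasSum_latticeCharFun (ha : ∀ z, 0 ≤ a z) (hs : HasSum a 1) (θ : ℝ) :
    HasSum (fun z : ℤ => (a z : ℂ) * Complex.exp ((z * θ : ℝ) * Complex.I))
      (latticeCharFun a θ) :=
  (Summable.of_norm (by simpa only [norm_latticeCharFun_term ha] using hs.summable)).hasSum

lemma continuous_latticeCharFun (ha : ∀ z, 0 ≤ a z) (hs : HasSum a 1) :
    Continuous (latticeCharFun a) :=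
  continuous_tsum (fun z => by fun_prop) hs.summable
    fun z θ => (norm_latticeCharFun_term ha z θ).le

lemma norm_latticeCharFun_le_one (ha : ∀ z, 0 ≤ a z) (hs : HasSum a 1) (θ : ℝ) :
    ‖latticeCharFun a θ‖ ≤ 1 :=
  (tsum_of_norm_bounded hs fun z => (norm_latticeCharFun_term ha z θ).le)

lemma integral_exp_int_mul_I (x : ℤ) :
    ∫ θ in (-π)..π, Complex.exp ((-(x * θ) : ℝ) * Complex.I) =
      if x = 0 then (2 * π : ℂ) else 0 := by
  split_ifs with h
  · simp [h]; ring
  · have hc : (-(x : ℂ) * Complex.I) ≠ 0 := by simp [h]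
    have := integral_exp_mul_complex (a := -π) (b := π) hc
    have e : ∀ θ : ℝ, Complex.exp ((-(x * θ) : ℝ) * Complex.I)
        = Complex.exp (-(x : ℂ) * Complex.I * θ) := fun θ => by
      congr 1; push_cast; ring
    simp_rw [e]
    rw [this, div_eq_zero_iff]
    left
    rw [sub_eq_zero, Complex.exp_eq_exp_iff_exists_int]
    exact ⟨-x, by push_cast; ring⟩

lemma convPow_eq_integral (ha : ∀ z, 0 ≤ a z) (hs : HasSum a 1) (n : ℕ) (x : ℤ) :
    (2 * π : ℂ) * convPow a n x =
      ∫ θ in (-π)..π, latticeCharFun a θ ^ n * Complex.exp ((-(x * θ) : ℝ) * Complex.I) := by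
  induction n generalizing x with
  | zero =>
    simp only [pow_zero, one_mul, integral_exp_int_mul_I, convPow]
    split_ifs <;> simp
  | succ n ih =>
    have hφ := continuous_latticeCharFun ha hs
    have key := intervalIntegral.hasSum_integral_of_dominated_convergence (μ := volume)
      (a := -π) (b := π)
      (F := fun (y : ℤ) θ => (a y : ℂ) * (latticeCharFun a θ ^ n *
        Complex.exp ((-((x - y : ℤ) * θ) : ℝ) * Complex.I)))
      (f := fun θ => latticeCharFun a θ ^ (n + 1) * Complex.exp ((-(x * θ) : ℝ) * Complex.I))
      (fun y _ => a y)
      (fun y => by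
        apply Continuous.aestronglyMeasurable
        fun_prop)
      (fun y => Eventually.of_forall fun θ _ => by
        rw [norm_mul, norm_mul, Complex.norm_exp_ofReal_mul_I, norm_pow, mul_one,
          Complex.norm_real, Real.norm_eq_abs, abs_of_nonneg (ha y)]
        exact mul_le_of_le_one_right (ha y)
          (pow_le_one₀ (norm_nonneg _) (norm_latticeCharFun_le_one ha hs θ)))
      (Eventually.of_forall fun _ _ => hs.summable)
      (by simp)
      (Eventually.of_forall fun θ _ => by
        have h := (hasSum_latticeCharFun ha hs θ).mul_left
          (latticeCharFun a θ ^ n * Complex.exp ((-(x * θ) : ℝ) * Complex.I))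
        convert h using 1
        · rfl
        · ext y
          have : Complex.exp ((-((x - y : ℤ) * θ) : ℝ) * Complex.I) =
              Complex.exp ((-(x * θ) : ℝ) * Complex.I) *
                Complex.exp ((y * θ : ℝ) * Complex.I) := by
            rw [← Complex.exp_add]; congr 1; push_cast; ring
          rw [this]; ring
        · ring)
    rw [← key.tsum_eq]
    simp only [convPow, Complex.ofReal_tsum]
    rw [← tsum_mul_left]
    refine tsum_congr fun y => ?_
    rw [intervalIntegral.integral_const_mul, ← ih]
    push_cast; ring

lemma heatKernel_zero_eq_integral (ha : ∀ z, 0 ≤ a z) (hs : HasSum a 1) (t : ℝ) :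
    (2 * π : ℂ) * heatKernel a 0 t =
      ∫ θ in (-π)..π, Complex.exp (-(t * (1 - latticeCharFun a θ))) := by
  have hφ := continuous_latticeCharFun ha hs
  have hexp : Summable fun n : ℕ => Real.exp (-t) * (|t| ^ n / n.factorial) :=
    (Real.summable_pow_div_factorial |t|).mul_left _
  have key := intervalIntegral.hasSum_integral_of_dominated_convergence (μ := volume)
      (a := -π) (b := π)
      (F := fun (n : ℕ) θ => ((Real.exp (-t) * t ^ n / n.factorial : ℝ) : ℂ) *
        latticeCharFun a θ ^ n)
      (f := fun θ => Complex.exp (-(t * (1 - latticeCharFun a θ))))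
      (fun n _ => Real.exp (-t) * (|t| ^ n / n.factorial))
      (fun y => by
        apply Continuous.aestronglyMeasurable
        fun_prop)
      (fun n => Eventually.of_forall fun θ _ => by
        rw [norm_mul, norm_pow, Complex.norm_real, Real.norm_eq_abs, mul_div_assoc, abs_mul,
          abs_div, abs_pow, abs_of_pos (Real.exp_pos _), Nat.abs_cast]
        exact mul_le_of_le_one_right (by positivity)
          (pow_le_one₀ (norm_nonneg _) (norm_latticeCharFun_le_one ha hs θ)))
      (Eventually.of_forall fun _ _ => hexp)
      (by simp)
      (Eventually.of_forall fun θ _ => by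
        have h := (NormedSpace.expSeries_div_hasSum_exp (𝔸 := ℂ)
          (t * latticeCharFun a θ)).mul_left (Complex.exp (-t))
        rw [← Complex.exp_eq_exp_ℂ, ← Complex.exp_add] at h
        convert h using 1
        · rfl
        · ext n
          push_cast; rw [mul_pow]; ring
        · congr 1; ring)
  rw [← key.tsum_eq]
  simp only [heatKernel, Complex.ofReal_tsum]
  rw [← tsum_mul_left]
  refine tsum_congr fun n => ?_
  rw [intervalIntegral.integral_const_mul]
  have := convPow_eq_integral ha hs n 0
  simp only [Int.cast_zero, zero_mul, neg_zero, Complex.ofReal_zero, Complex.exp_zero,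
    mul_one] at this
  rw [← this]
  push_cast; ring

end LatticeFourier

section LocalLimit

open Filter Topology MeasureTheory

variable {a : ℤ → ℝ}

lemma norm_exp_ofReal_mul_I_sub_one_sub_le (x : ℝ) :
    ‖Complex.exp (x * Complex.I) - 1 - x * Complex.I‖ ≤ 3 * x ^ 2 := by
  have hx : ‖(x : ℂ) * Complex.I‖ = |x| := by simp
  rcases le_or_gt |x| 1 with h | h
  · have := Complex.norm_exp_sub_one_sub_id_le (x := x * Complex.I) (by rwa [hx])
    rw [hx, sq_abs] at this
    nlinarith [sq_nonneg x]
  · have h1 : ‖Complex.exp (x * Complex.I) - 1 - x * Complex.I‖ ≤ 1 + 1 + |x| := by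
      refine (norm_sub_le _ _).trans (add_le_add ((norm_sub_le _ _).trans ?_) hx.le)
      rw [Complex.norm_exp_ofReal_mul_I, norm_one]
    rw [← sq_abs]
    nlinarith

lemma tendsto_exp_ofReal_mul_I_second_order (z : ℤ) :
    Tendsto (fun θ : ℝ => (1 + (z * θ : ℝ) * Complex.I -
        Complex.exp ((z * θ : ℝ) * Complex.I)) / (θ : ℂ) ^ 2) (𝓝[≠] 0)
      (𝓝 ((z : ℂ) ^ 2 / 2)) := by
  rw [tendsto_iff_norm_sub_tendsto_zero]
  have h0 : Tendsto (fun θ : ℝ => |(z : ℝ)| ^ 3 * |θ|) (𝓝[≠] 0) (𝓝 0) := by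
    have : Continuous fun θ : ℝ => |(z : ℝ)| ^ 3 * |θ| := by fun_prop
    simpa using (this.tendsto 0).mono_left nhdsWithin_le_nhds
  have hsmall : ∀ᶠ θ : ℝ in 𝓝[≠] 0, |(z : ℝ) * θ| < 1 := by
    have : Continuous fun θ : ℝ => |(z : ℝ) * θ| := by fun_prop
    have h := (this.tendsto 0).mono_left (nhdsWithin_le_nhds (s := {0}ᶜ))
    exact h.eventually_lt_const (by simp)
  refine squeeze_zero' (Eventually.of_forall fun _ => norm_nonneg _) ?_ h0
  filter_upwards [hsmall, self_mem_nhdsWithin] with θ h1 hθ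
  have hθ0 : θ ≠ 0 := hθ
  have hθ' : (θ : ℂ) ≠ 0 := by simpa using hθ
  have hw : ‖((z * θ : ℝ) : ℂ) * Complex.I‖ = |(z : ℝ) * θ| := by
    rw [norm_mul, Complex.norm_I, mul_one, Complex.norm_real, Real.norm_eq_abs]
  have hb := Complex.exp_bound (x := ((z * θ : ℝ) : ℂ) * Complex.I) (hw.trans_le h1.le)
    (n := 3) (by norm_num)
  rw [hw] at hb
  simp only [Finset.sum_range_succ, Finset.sum_range_zero, pow_zero, Nat.factorial] at hb
  have e : (1 + (z * θ : ℝ) * Complex.I -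
        Complex.exp ((z * θ : ℝ) * Complex.I)) / (θ : ℂ) ^ 2 - (z : ℂ) ^ 2 / 2
      = -(Complex.exp ((z * θ : ℝ) * Complex.I) - (1 + (z * θ : ℝ) * Complex.I
          + ((z * θ : ℝ) * Complex.I) ^ 2 / 2)) / (θ : ℂ) ^ 2 := by
    rw [mul_pow, Complex.I_sq]
    push_cast
    field_simp
    ring
  rw [e, norm_div, norm_neg, norm_pow, Complex.norm_real, Real.norm_eq_abs,
    div_le_iff₀ (by positivity)]
  calc _ ≤ |(z : ℝ) * θ| ^ 3 := by
        refine le_trans (le_of_eq ?_) (hb.trans ?_)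
        · congr 2; norm_num
        · refine mul_le_of_le_one_right (by positivity) ?_
          norm_num
    _ = _ := by rw [abs_mul]; ring

lemma hasSum_one_sub_latticeCharFun (ha : ∀ z, 0 ≤ a z) (hs : HasSum a 1)
    (hm : HasSum (fun z : ℤ => (z : ℝ) * a z) 0) (θ : ℝ) :
    HasSum (fun z : ℤ => (a z : ℂ) * ((1 + (z * θ : ℝ) * Complex.I -
        Complex.exp ((z * θ : ℝ) * Complex.I)) / (θ : ℂ) ^ 2))
      ((1 - latticeCharFun a θ) / (θ : ℂ) ^ 2) := by
  have h1 : HasSum (fun z => (a z : ℂ)) (1 : ℝ) := Complex.hasSum_ofReal.mpr hs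
  have h2 : HasSum (fun z : ℤ => (((z : ℝ) * a z : ℝ) : ℂ)) (0 : ℝ) :=
    Complex.hasSum_ofReal.mpr hm
  have h := ((h1.add (h2.mul_right (θ * Complex.I))).sub
    (hasSum_latticeCharFun ha hs θ)).div_const ((θ : ℂ) ^ 2)
  rw [Complex.ofReal_zero, zero_mul, add_zero, Complex.ofReal_one] at h
  refine h.congr_fun fun z => ?_
  push_cast; ring

lemma tendsto_one_sub_latticeCharFun (ha : ∀ z, 0 ≤ a z) (hs : HasSum a 1)
    (hm : HasSum (fun z : ℤ => (z : ℝ) * a z) 0) {V : ℝ}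
    (hv : HasSum (fun z : ℤ => (z : ℝ) ^ 2 * a z) V) :
    Tendsto (fun θ : ℝ => (1 - latticeCharFun a θ) / (θ : ℂ) ^ 2) (𝓝[≠] 0)
      (𝓝 ((V : ℂ) / 2)) := by
  have hV : HasSum (fun z : ℤ => (a z : ℂ) * ((z : ℂ) ^ 2 / 2)) ((V : ℂ) / 2) := by
    have := (Complex.hasSum_ofReal.mpr hv).div_const (2 : ℂ)
    refine this.congr_fun fun z => ?_
    push_cast; ring
  rw [← hV.tsum_eq]
  have := tendsto_tsum_of_dominated_convergence (𝓕 := 𝓝[≠] (0 : ℝ))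
    (f := fun θ (z : ℤ) => (a z : ℂ) * ((1 + (z * θ : ℝ) * Complex.I -
        Complex.exp ((z * θ : ℝ) * Complex.I)) / (θ : ℂ) ^ 2))
    (g := fun z : ℤ => (a z : ℂ) * ((z : ℂ) ^ 2 / 2))
    (bound := fun z : ℤ => 3 * ((z : ℝ) ^ 2 * a z)) (hv.summable.mul_left 3)
    (fun z => (tendsto_exp_ofReal_mul_I_second_order z).const_mul _)
    (by
      filter_upwards [self_mem_nhdsWithin] with θ hθ z
      have hθ' : θ ≠ 0 := hθ
      rw [norm_mul, Complex.norm_real, Real.norm_eq_abs, abs_of_nonneg (ha z), norm_div,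
        norm_pow, Complex.norm_real, Real.norm_eq_abs, sq_abs]
      have h1 := norm_exp_ofReal_mul_I_sub_one_sub_le (z * θ)
      rw [← norm_neg] at h1
      have h2 : ‖1 + ((z * θ : ℝ) : ℂ) * Complex.I -
          Complex.exp ((z * θ : ℝ) * Complex.I)‖ / θ ^ 2 ≤ 3 * (z : ℝ) ^ 2 := by
        rw [div_le_iff₀ (by positivity)]
        rw [show 3 * (z : ℝ) ^ 2 * θ ^ 2 = 3 * (z * θ) ^ 2 by ring]
        refine le_trans (le_of_eq ?_) h1
        congr 1; ring
      nlinarith [ha z])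
  refine this.congr fun θ => ?_
  exact (hasSum_one_sub_latticeCharFun ha hs hm θ).tsum_eq

lemma hasSum_one_sub_re_latticeCharFun (ha : ∀ z, 0 ≤ a z) (hs : HasSum a 1) (θ : ℝ) :
    HasSum (fun z : ℤ => a z * (1 - Real.cos (z * θ))) (1 - (latticeCharFun a θ).re) := by
  have h := hs.sub (Complex.hasSum_re (hasSum_latticeCharFun ha hs θ))
  refine h.congr_fun fun z => ?_
  rw [Complex.re_ofReal_mul, Complex.exp_ofReal_mul_I_re]
  ring

lemma re_latticeCharFun_lt_one (ha : ∀ z, 0 ≤ a z) (hs : HasSum a 1)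
    (hgen : AddSubgroup.closure (Function.support a) = (⊤ : AddSubgroup ℤ))
    {θ : ℝ} (hθ : |θ| ≤ π) (h0 : θ ≠ 0) : 0 < 1 - (latticeCharFun a θ).re := by
  have hsum := hasSum_one_sub_re_latticeCharFun ha hs θ
  have hnn (z : ℤ) : 0 ≤ a z * (1 - Real.cos (z * θ)) :=
    mul_nonneg (ha z) (sub_nonneg.mpr (Real.cos_le_one _))
  refine (hsum.nonneg hnn).lt_of_ne fun h => h0 ?_
  rw [← h, hasSum_zero_iff_of_nonneg hnn] at hsum
  have hall : ∀ z : ℤ, ∃ k : ℤ, (k : ℝ) * (2 * π) = z * θ := fun z => by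
    have hz : z ∈ AddSubgroup.closure (Function.support a) := hgen ▸ AddSubgroup.mem_top z
    induction hz using AddSubgroup.closure_induction with
    | mem x hx =>
      have := congrFun hsum x
      rw [Pi.zero_apply, mul_eq_zero, or_iff_right hx, sub_eq_zero, eq_comm,
        Real.cos_eq_one_iff] at this
      exact this
    | zero => exact ⟨0, by simp⟩
    | add x y _ _ hx hy =>
      obtain ⟨k, hk⟩ := hx
      obtain ⟨l, hl⟩ := hy
      exact ⟨k + l, by push_cast; linarith⟩
    | neg x _ hx =>
      obtain ⟨k, hk⟩ := hx
      exact ⟨-k, by push_cast; linarith⟩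
  obtain ⟨k, hk⟩ := hall 1
  have hcos : Real.cos θ = 1 := (Real.cos_eq_one_iff _).mpr ⟨k, by simpa using hk⟩
  rw [abs_le] at hθ
  exact (Real.cos_eq_one_iff_of_lt_of_lt (by linarith [Real.pi_pos])
    (by linarith [Real.pi_pos])).mp hcos

lemma exists_sq_le_one_sub_re_latticeCharFun (ha : ∀ z, 0 ≤ a z) (hs : HasSum a 1)
    (hm : HasSum (fun z : ℤ => (z : ℝ) * a z) 0) {V : ℝ} (hVpos : 0 < V)
    (hv : HasSum (fun z : ℤ => (z : ℝ) ^ 2 * a z) V)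
    (hgen : AddSubgroup.closure (Function.support a) = (⊤ : AddSubgroup ℤ)) :
    ∃ c > 0, ∀ θ : ℝ, |θ| ≤ π → c * θ ^ 2 ≤ 1 - (latticeCharFun a θ).re := by
  classical
  set h : ℝ → ℝ := Function.update (fun θ => (1 - (latticeCharFun a θ).re) / θ ^ 2) 0 (V / 2)
  have hlim : Tendsto (fun θ : ℝ => (1 - (latticeCharFun a θ).re) / θ ^ 2) (𝓝[≠] 0)
      (𝓝 (V / 2)) := by
    have := (Complex.continuous_re.tendsto _).comp (tendsto_one_sub_latticeCharFun ha hs hm hv)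
    have e : (V / 2 : ℂ).re = V / 2 := by
      rw [show (V / 2 : ℂ) = ((V / 2 : ℝ) : ℂ) by push_cast; rfl, Complex.ofReal_re]
    rw [e] at this
    refine this.congr fun θ => ?_
    simp only [Function.comp]
    rw [← Complex.ofReal_pow, Complex.div_ofReal_re]
    simp
  have hcont : Continuous h := by
    rw [continuous_iff_continuousAt]
    intro θ
    by_cases hθ : θ = 0
    · rw [hθ]; exact continuousAt_update_same.mpr hlim
    · rw [continuousAt_update_of_ne hθ]
      have := (Complex.continuous_re.comp (continuous_latticeCharFun ha hs)).continuousAt (x := θ)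
      exact (continuousAt_const.sub this).div (by fun_prop) (by positivity)
  obtain ⟨θ₀, hθ₀, hmin⟩ := (isCompact_Icc (a := -π) (b := π)).exists_isMinOn
    ⟨0, by constructor <;> linarith [Real.pi_pos]⟩ hcont.continuousOn
  refine ⟨h θ₀, ?_, fun θ hθ => ?_⟩
  · by_cases h0 : θ₀ = 0
    · simp only [h0, h, Function.update_self, gt_iff_lt]; linarith
    · simp only [h, Function.update_of_ne h0]
      exact div_pos (re_latticeCharFun_lt_one ha hs hgen (abs_le.mpr hθ₀) h0) (by positivity)
  · by_cases h0 : θ = 0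
    · subst h0
      simpa using (hasSum_one_sub_re_latticeCharFun ha hs 0).nonneg fun z =>
        mul_nonneg (ha z) (sub_nonneg.mpr (Real.cos_le_one _))
    · have := hmin (show θ ∈ Set.Icc (-π) π from abs_le.mp hθ)
      simp only [Set.mem_ofPred_eq] at this
      rw [show h θ = _ from Function.update_of_ne h0 _ _, le_div_iff₀ (by positivity)] at this
      exact this

/-- Local central limit theorem at the origin for the continuous-time walk. -/
lemma tendsto_sqrt_mul_heatKernel (ha : ∀ z, 0 ≤ a z) (hs : HasSum a 1)
    (hm : HasSum (fun z : ℤ => (z : ℝ) * a z) 0) {σ : ℝ} (hσ : 0 < σ)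
    (hv : HasSum (fun z : ℤ => (z : ℝ) ^ 2 * a z) (σ ^ 2))
    (hgen : AddSubgroup.closure (Function.support a) = (⊤ : AddSubgroup ℤ)) :
    Tendsto (fun t => √t * heatKernel a 0 t) atTop (𝓝 (1 / (σ * √(2 * π)))) := by
  obtain ⟨c, hc, hlow⟩ := exists_sq_le_one_sub_re_latticeCharFun ha hs hm (by positivity) hv hgen
  have hφ := continuous_latticeCharFun ha hs
  set F : ℝ → ℝ → ℂ := fun t => (Set.Ioc (-(π * √t)) (π * √t)).indicator
    fun u => Complex.exp (-(t * (1 - latticeCharFun a (u / √t)))) with hF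
  have hrep : ∀ t > 0, ∫ u, F t u = (2 * π : ℂ) * (√t * heatKernel a 0 t : ℝ) := by
    intro t ht
    have hst : √t ≠ 0 := (Real.sqrt_pos.mpr ht).ne'
    rw [hF, integral_indicator measurableSet_Ioc, ← intervalIntegral.integral_of_le
      (by have := Real.pi_pos; have := Real.sqrt_nonneg t; nlinarith)]
    have := intervalIntegral.integral_comp_div (a := -(π * √t)) (b := π * √t)
      (fun θ => Complex.exp (-(t * (1 - latticeCharFun a θ)))) hst
    rw [this, show -(π * √t) / √t = -π by field_simp, show π * √t / √t = π by field_simp,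
      ← heatKernel_zero_eq_integral ha hs, Complex.real_smul]
    push_cast; ring
  have hlimF : Tendsto (fun t => ∫ u, F t u) atTop
      (𝓝 (∫ u : ℝ, ((Real.exp (-(σ ^ 2 / 2) * u ^ 2) : ℝ) : ℂ))) := by
    refine tendsto_integral_filter_of_dominated_convergence
      (fun u => Real.exp (-c * u ^ 2)) ?_ ?_ (integrable_exp_neg_mul_sq hc) ?_
    · refine Eventually.of_forall fun t => ?_
      exact (Continuous.aestronglyMeasurable (by fun_prop)).indicator measurableSet_Ioc
    · filter_upwards [eventually_gt_atTop 0] with t ht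
      refine Eventually.of_forall fun u => ?_
      have hst : 0 < √t := Real.sqrt_pos.mpr ht
      simp only [hF, Set.indicator]
      split_ifs with hu
      · rw [Complex.norm_exp, Real.exp_le_exp]
        have h1 := hlow (u / √t) (by
          rw [abs_div, abs_of_pos hst, div_le_iff₀ hst, abs_le]; exact ⟨hu.1.le, hu.2⟩)
        rw [div_pow, Real.sq_sqrt ht.le] at h1
        rw [Complex.neg_re, Complex.re_ofReal_mul, Complex.sub_re, Complex.one_re]
        have h2 := mul_le_mul_of_nonneg_left h1 ht.le
        have h3 : t * (c * (u ^ 2 / t)) = c * u ^ 2 := by field_simp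
        linarith
      · simpa using (Real.exp_pos _).le
    · have hae : ∀ᵐ u : ℝ, u ≠ 0 := by simp [ae_iff]
      filter_upwards [hae] with u hu
      have hsq : Tendsto (fun t : ℝ => u / √t) atTop (𝓝[≠] 0) := by
        refine tendsto_nhdsWithin_iff.mpr
          ⟨Real.tendsto_sqrt_atTop.const_div_atTop u, ?_⟩
        filter_upwards [eventually_gt_atTop 0] with t ht
        exact div_ne_zero hu (Real.sqrt_pos.mpr ht).ne'
      have h1 := (tendsto_one_sub_latticeCharFun ha hs hm hv).comp hsq
      have h2 : Tendsto (fun t : ℝ => Complex.exp (-(t * (1 - latticeCharFun a (u / √t)))))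
          atTop (𝓝 ((Real.exp (-(σ ^ 2 / 2) * u ^ 2) : ℝ) : ℂ)) := by
        rw [Complex.ofReal_exp]
        refine (Complex.continuous_exp.tendsto _).comp ?_
        have h3 := (h1.mul_const ((u : ℂ) ^ 2)).neg
        convert h3.congr' ?_ using 2
        · push_cast; ring
        · filter_upwards [eventually_gt_atTop 0] with t ht
          have hst : (√t : ℂ) ≠ 0 := by
            exact_mod_cast (Real.sqrt_pos.mpr ht).ne'
          have hsq : (√t : ℂ) ^ 2 = t := by exact_mod_cast Real.sq_sqrt ht.le
          have hu' : (u : ℂ) ≠ 0 := by exact_mod_cast hu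
          simp only [Function.comp]
          push_cast
          rw [div_pow, hsq]
          field_simp
      refine h2.congr' ?_
      have hlarge : ∀ᶠ t : ℝ in atTop, |u| < π * √t :=
        (Real.tendsto_sqrt_atTop.const_mul_atTop Real.pi_pos).eventually_gt_atTop _
      filter_upwards [hlarge] with t ht
      rw [abs_lt] at ht
      simp only [hF]
      rw [Set.indicator_of_mem (show u ∈ Set.Ioc (-(π * √t)) (π * √t) from ⟨ht.1, ht.2.le⟩)]
  rw [integral_complex_ofReal, integral_gaussian] at hlimF
  have h4 := ((Complex.continuous_re.tendsto _).comp hlimF).div_const (2 * π)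
  simp only [Complex.ofReal_re] at h4
  convert h4.congr' ?_ using 2
  · have hπ := Real.pi_pos
    rw [div_eq_div_iff (by positivity) (by positivity)]
    have e1 : √(π / (σ ^ 2 / 2)) = √(2 * π) / σ := by
      rw [show π / (σ ^ 2 / 2) = (2 * π) / σ ^ 2 by field_simp,
        Real.sqrt_div (by positivity), Real.sqrt_sq hσ.le]
    rw [e1]
    field_simp
    rw [Real.sq_sqrt (by positivity)]
  · filter_upwards [eventually_gt_atTop 0] with t ht
    simp only [Function.comp]
    rw [hrep t ht, show (2 * π : ℂ) = ((2 * π : ℝ) : ℂ) by push_cast; rfl,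
      Complex.re_ofReal_mul, Complex.ofReal_re]
    field_simp

end LocalLimit

section Volterra

open MeasureTheory Set
open scoped ENNReal

/-- The restriction of a real function to the open half-line, as an `ℝ≥0∞`-valued function. -/
noncomputable def halfLine (k : ℝ → ℝ) : ℝ → ℝ≥0∞ :=
  (Ioi 0).indicator fun x => ENNReal.ofReal (k x)

lemma aemeasurable_halfLine {k : ℝ → ℝ} (hk : AEMeasurable k (volume.restrict (Ioi 0))) :
    AEMeasurable (halfLine k) :=
  (aemeasurable_indicator_iff measurableSet_Ioi).mpr hk.ennreal_ofReal

lemma lconvolution_halfLine {g k : ℝ → ℝ} (hg : ∀ x > 0, 0 ≤ g x) (t : ℝ) :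
    lconvolution (halfLine g) (halfLine k) volume t =
      ∫⁻ s in Ioo 0 t, ENNReal.ofReal (k (t - s) * g s) := by
  rw [lconvolution_def, ← lintegral_indicator measurableSet_Ioo]
  refine lintegral_congr fun s => ?_
  simp only [halfLine, indicator, mem_Ioi, mem_Ioo]
  by_cases h1 : 0 < s
  · by_cases h2 : s < t
    · rw [if_pos h1, if_pos (by linarith), if_pos ⟨h1, h2⟩, mul_comm (k (t - s)),
        ENNReal.ofReal_mul (hg s h1), neg_add_eq_sub]
    · rw [if_neg (show ¬ 0 < -s + t by linarith), mul_zero, if_neg (by tauto)]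
  · rw [if_neg h1, zero_mul, if_neg (by tauto)]

lemma aemeasurable_comp_const_sub {k : ℝ → ℝ} (hk : AEMeasurable k (volume.restrict (Ioi 0)))
    (t : ℝ) : AEMeasurable (fun s => k (t - s)) (volume.restrict (Ioo 0 t)) := by
  have h := (Measure.measurePreserving_sub_left volume t).restrict_preimage (s := Ioi (0 : ℝ))
    measurableSet_Ioi
  refine (hk.comp_quasiMeasurePreserving h.quasiMeasurePreserving).mono_measure
    (Measure.restrict_mono ?_ le_rfl)
  intro s hs
  simpa using hs.2

lemma toReal_lconvolution_halfLine {g k : ℝ → ℝ} (hg : ∀ x > 0, 0 ≤ g x)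
    (hk : ∀ x > 0, 0 ≤ k x) (hgm : AEMeasurable g (volume.restrict (Ioi 0)))
    (hkm : AEMeasurable k (volume.restrict (Ioi 0))) {t : ℝ} (ht : 0 ≤ t) :
    (lconvolution (halfLine g) (halfLine k) volume t).toReal =
      ∫ s in (0 : ℝ)..t, k (t - s) * g s := by
  rw [lconvolution_halfLine hg, intervalIntegral.integral_of_le ht,
    integral_Ioc_eq_integral_Ioo, integral_eq_lintegral_of_nonneg_ae]
  · exact (ae_restrict_iff' measurableSet_Ioo).mpr <| ae_of_all _ fun s hs =>
      mul_nonneg (hk _ (sub_pos.mpr hs.2)) (hg _ hs.1)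
  · exact ((aemeasurable_comp_const_sub hkm t).mul
      (hgm.mono_measure (Measure.restrict_mono (fun s hs => hs.1) le_rfl))).aestronglyMeasurable

lemma lconvolution_halfLine_eq {g k : ℝ → ℝ} (hg : ∀ x > 0, 0 ≤ g x)
    (hk : ∀ x > 0, 0 ≤ k x)
    (hint : ∀ t > 0, IntervalIntegrable (fun s => k (t - s) * g s) volume 0 t) :
    lconvolution (halfLine g) (halfLine k) volume =
      halfLine fun t => ∫ s in (0 : ℝ)..t, k (t - s) * g s := by
  ext t
  rw [lconvolution_halfLine hg]
  simp only [halfLine, indicator, mem_Ioi]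
  split_ifs with ht
  · rw [intervalIntegral.integral_of_le ht.le, integral_Ioc_eq_integral_Ioo,
      ofReal_integral_eq_lintegral_ofReal]
    · exact ((intervalIntegrable_iff_integrableOn_Ioc_of_le ht.le).mp (hint t ht)).mono_set
        Ioo_subset_Ioc_self
    · exact (ae_restrict_iff' measurableSet_Ioo).mpr <| ae_of_all _ fun s hs =>
        mul_nonneg (hk _ (sub_pos.mpr hs.2)) (hg _ hs.1)
  · rw [Ioo_eq_empty (by simpa using ht)]; simp

lemma volterra_nonneg {g k : ℝ → ℝ} (hg : ∀ x > 0, 0 ≤ g x) (hk : ∀ x > 0, 0 ≤ k x)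
    {t : ℝ} (ht : 0 < t) : 0 ≤ ∫ s in (0 : ℝ)..t, k (t - s) * g s := by
  rw [intervalIntegral.integral_of_le ht.le, integral_Ioc_eq_integral_Ioo]
  exact setIntegral_nonneg measurableSet_Ioo fun s hs =>
    mul_nonneg (hk _ (sub_pos.mpr hs.2)) (hg _ hs.1)

lemma aemeasurable_volterra {g k : ℝ → ℝ} (hg : ∀ x > 0, 0 ≤ g x)
    (hk : ∀ x > 0, 0 ≤ k x) (hgm : AEMeasurable g (volume.restrict (Ioi 0)))
    (hkm : AEMeasurable k (volume.restrict (Ioi 0))) :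
    AEMeasurable (fun t => ∫ s in (0 : ℝ)..t, k (t - s) * g s) (volume.restrict (Ioi 0)) := by
  have h := (aemeasurable_lconvolution (μ := volume)
    (aemeasurable_halfLine hgm) (aemeasurable_halfLine hkm)).ennreal_toReal
  refine h.restrict.congr ((ae_restrict_iff' measurableSet_Ioi).mpr <| ae_of_all _ fun t ht => ?_)
  exact toReal_lconvolution_halfLine hg hk hgm hkm (le_of_lt ht)

/-- Associativity of the Volterra convolution of nonnegative functions on the half-line. -/
lemma volterra_assoc {k g u : ℝ → ℝ} (hk : ∀ x > 0, 0 ≤ k x) (hg : ∀ x > 0, 0 ≤ g x)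
    (hu : ∀ x > 0, 0 ≤ u x) (hkm : AEMeasurable k (volume.restrict (Ioi 0)))
    (hgm : AEMeasurable g (volume.restrict (Ioi 0)))
    (hum : AEMeasurable u (volume.restrict (Ioi 0)))
    (hkg : ∀ t > 0, IntervalIntegrable (fun s => k (t - s) * g s) volume 0 t)
    (hgu : ∀ t > 0, IntervalIntegrable (fun s => g (t - s) * u s) volume 0 t)
    {t : ℝ} (ht : 0 ≤ t) :
    ∫ s in (0 : ℝ)..t, k (t - s) * ∫ r in (0 : ℝ)..s, g (s - r) * u r =
      ∫ s in (0 : ℝ)..t, (∫ r in (0 : ℝ)..(t - s), k (t - s - r) * g r) * u s := by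
  rw [← toReal_lconvolution_halfLine (fun x hx => volterra_nonneg hu hg hx) hk
    (aemeasurable_volterra hu hg hum hgm) hkm ht,
    ← toReal_lconvolution_halfLine
      (k := fun s => ∫ r in (0 : ℝ)..s, k (s - r) * g r) hu
      (fun x hx => volterra_nonneg hg hk hx) hum (aemeasurable_volterra hg hk hgm hkm) ht,
    ← lconvolution_halfLine_eq hu hg hgu, ← lconvolution_halfLine_eq hg hk hkg,
    lconvolution_assoc₀ (aemeasurable_halfLine hum) (aemeasurable_halfLine hgm)
      (aemeasurable_halfLine hkm)]

end Volterra

section AbelKernel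

open Filter Topology MeasureTheory Set

lemma hasDerivAt_arcsin_affine {t s : ℝ} (hs : s ∈ Ioo 0 t) :
    HasDerivAt (fun s => Real.arcsin (2 * s / t - 1)) ((√(t - s))⁻¹ * (√s)⁻¹) s := by
  obtain ⟨h0, h1⟩ := hs
  have ht : 0 < t := h0.trans h1
  have hd : HasDerivAt (fun s : ℝ => 2 * s / t - 1) (2 / t) s := by
    simpa using (((hasDerivAt_id s).const_mul 2).div_const t).sub_const 1
  have hlt : 2 * s / t < 2 := by rw [div_lt_iff₀ ht]; linarith
  have hpos : 0 < 2 * s / t := by positivity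
  refine ((Real.hasDerivAt_arcsin (x := 2 * s / t - 1) (by linarith) (by linarith)).comp s
    hd).congr_deriv ?_
  have e : 1 - (2 * s / t - 1) ^ 2 = (2 / t) ^ 2 * ((t - s) * s) := by field_simp; ring
  rw [e, Real.sqrt_mul (by positivity), Real.sqrt_sq (by positivity),
    Real.sqrt_mul (by linarith)]
  have := Real.sqrt_pos.mpr h0
  have := Real.sqrt_pos.mpr (sub_pos.mpr h1)
  field_simp

lemma intervalIntegrable_abelKernel {t : ℝ} (ht : 0 < t) :
    IntervalIntegrable (fun s => (√(t - s))⁻¹ * (√s)⁻¹) volume 0 t := by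
  rw [intervalIntegrable_iff_integrableOn_Ioc_of_le ht.le]
  exact intervalIntegral.integrableOn_deriv_of_nonneg
    (g := fun s => Real.arcsin (2 * s / t - 1))
    (Real.continuous_arcsin.comp (by fun_prop)).continuousOn
    (fun s hs => hasDerivAt_arcsin_affine hs) (fun s _ => by positivity)

lemma integral_abelKernel {t : ℝ} (ht : 0 < t) :
    ∫ s in (0 : ℝ)..t, (√(t - s))⁻¹ * (√s)⁻¹ = π := by
  rw [intervalIntegral.integral_eq_sub_of_hasDerivAt_of_le ht.le
    (f := fun s => Real.arcsin (2 * s / t - 1))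
    (Real.continuous_arcsin.comp (by fun_prop)).continuousOn
    (fun s hs => hasDerivAt_arcsin_affine hs) (intervalIntegrable_abelKernel ht)]
  rw [mul_div_assoc, div_self ht.ne']
  norm_num

lemma hasDerivAt_neg_two_mul_sqrt_sub {t s : ℝ} (hs : s < t) :
    HasDerivAt (fun s => -2 * √(t - s)) ((√(t - s))⁻¹) s := by
  have h : HasDerivAt (fun s => t - s) (-1) s := by
    simpa using (hasDerivAt_id s).const_sub t
  refine ((h.sqrt (sub_pos.mpr hs).ne').const_mul (-2)).congr_deriv ?_
  have := Real.sqrt_pos.mpr (sub_pos.mpr hs)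
  field_simp

lemma intervalIntegrable_inv_sqrt_sub {t : ℝ} (ht : 0 < t) :
    IntervalIntegrable (fun s => (√(t - s))⁻¹) volume 0 t := by
  rw [intervalIntegrable_iff_integrableOn_Ioc_of_le ht.le]
  exact intervalIntegral.integrableOn_deriv_of_nonneg (g := fun s => -2 * √(t - s))
    (by fun_prop) (fun s hs => hasDerivAt_neg_two_mul_sqrt_sub hs.2) (fun s _ => by positivity)

lemma integral_inv_sqrt_one_sub :
    ∫ s in (0 : ℝ)..1, (√(1 - s))⁻¹ = 2 := by
  rw [intervalIntegral.integral_eq_sub_of_hasDerivAt_of_le zero_le_one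
    (f := fun s => -2 * √(1 - s)) (by fun_prop)
    (fun s hs => hasDerivAt_neg_two_mul_sqrt_sub hs.2)
    (intervalIntegrable_inv_sqrt_sub zero_lt_one)]
  norm_num

/-- A kernel on the half-line with square-root decay, `√t * p t → c`. -/
structure SqrtDecay (p : ℝ → ℝ) (c : ℝ) : Prop where
  cont : Continuous p
  nonneg : ∀ t ≥ 0, 0 ≤ p t
  le_one : ∀ t ≥ 0, p t ≤ 1
  pos : 0 < c
  tendsto : Tendsto (fun t => √t * p t) atTop (𝓝 c)

namespace SqrtDecay

variable {p : ℝ → ℝ} {c : ℝ}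

lemma exists_bound (hp : SqrtDecay p c) : ∃ C > 0, ∀ t > 0, p t ≤ C * (√t)⁻¹ := by
  obtain ⟨T, hT⟩ := eventually_atTop.mp (hp.tendsto.eventually_le_const (lt_add_one c))
  have hc := hp.pos
  refine ⟨max (c + 1) (√T), lt_max_of_lt_left (by linarith), fun t ht => ?_⟩
  rw [← div_eq_mul_inv, le_div_iff₀ (Real.sqrt_pos.mpr ht), mul_comm]
  rcases le_total T t with h | h
  · exact (hT t h).trans (le_max_left _ _)
  · exact (mul_le_of_le_one_right (Real.sqrt_nonneg _) (hp.le_one t ht.le)).trans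
      ((Real.sqrt_le_sqrt h).trans (le_max_right _ _))

lemma eventually_lower (hp : SqrtDecay p c) :
    ∃ T > 0, ∀ t ≥ T, c / 2 * (√t)⁻¹ ≤ p t := by
  obtain ⟨T, hT⟩ := eventually_atTop.mp
    (hp.tendsto.eventually_const_le (half_lt_self hp.pos))
  refine ⟨max T 1, by positivity, fun t ht => ?_⟩
  have h1 : 0 < t := by linarith [le_max_right T 1]
  rw [← div_eq_mul_inv, div_le_iff₀ (Real.sqrt_pos.mpr h1), mul_comm]
  exact hT t ((le_max_left _ _).trans ht)

lemma almost_antitone (hp : SqrtDecay p c) {ε : ℝ} (hε : 0 < ε) :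
    ∃ T > 0, ∀ r ≥ T, ∀ r' ≥ r, p r' ≤ (1 + ε) * p r := by
  have hc := hp.pos
  obtain ⟨T₁, h₁⟩ := eventually_atTop.mp (hp.tendsto.eventually_const_le
    (show c * (1 - ε / (2 + ε)) < c by
      have : 0 < c * (ε / (2 + ε)) := by positivity
      linarith))
  obtain ⟨T₂, h₂⟩ := eventually_atTop.mp (hp.tendsto.eventually_le_const
    (show c < c * (1 + ε / (2 + ε)) by
      have : 0 < c * (ε / (2 + ε)) := by positivity
      linarith))
  refine ⟨max (max T₁ T₂) 1, by positivity, fun r hr r' hr' => ?_⟩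
  have hr1 : T₁ ≤ r := (le_max_left _ _).trans ((le_max_left _ _).trans hr)
  have hr2 : T₂ ≤ r := (le_max_right _ _).trans ((le_max_left _ _).trans hr)
  have hr0 : 0 < r := by linarith [le_max_right (max T₁ T₂) 1]
  have hs : 0 < √r := Real.sqrt_pos.mpr hr0
  have hs' : √r ≤ √r' := Real.sqrt_le_sqrt hr'
  have e : c * (1 + ε / (2 + ε)) = (1 + ε) * (c * (1 - ε / (2 + ε))) := by
    field_simp; ring
  have key : √r * p r' ≤ √r * ((1 + ε) * p r) := by
    calc √r * p r' ≤ √r' * p r' :=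
          mul_le_mul_of_nonneg_right hs' (hp.nonneg _ (by linarith))
      _ ≤ c * (1 + ε / (2 + ε)) := h₂ r' (hr2.trans hr')
      _ = (1 + ε) * (c * (1 - ε / (2 + ε))) := e
      _ ≤ (1 + ε) * (√r * p r) := mul_le_mul_of_nonneg_left (h₁ r hr1) (by linarith)
      _ = _ := by ring
  exact le_of_mul_le_mul_left key hs

lemma intervalIntegrable_abel (hp : SqrtDecay p c) {t : ℝ} (ht : 0 < t) :
    IntervalIntegrable (fun s => (√(t - s))⁻¹ * p s) volume 0 t :=
  (intervalIntegrable_inv_sqrt_sub ht).mul_continuousOn hp.cont.continuousOn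

lemma abel_bound (hp : SqrtDecay p c) {C : ℝ} (hC : ∀ t > 0, p t ≤ C * (√t)⁻¹)
    {t : ℝ} (ht : 0 < t) :
    ∫ s in (0 : ℝ)..t, (√(t - s))⁻¹ * p s ≤ C * π := by
  rw [← integral_abelKernel ht, ← intervalIntegral.integral_const_mul]
  refine intervalIntegral.integral_mono_on_of_le_Ioo ht.le (hp.intervalIntegrable_abel ht)
    ((intervalIntegrable_abelKernel ht).const_mul C) fun s hs => ?_
  calc (√(t - s))⁻¹ * p s ≤ (√(t - s))⁻¹ * (C * (√s)⁻¹) := by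
        gcongr; exact hC s hs.1
    _ = _ := by ring

/-- The Abel transform of a kernel with square-root decay converges. -/
lemma abel_tendsto (hp : SqrtDecay p c) :
    Tendsto (fun t => ∫ s in (0 : ℝ)..t, (√(t - s))⁻¹ * p s) atTop (𝓝 (c * π)) := by
  obtain ⟨C, hC0, hC⟩ := hp.exists_bound
  have hrep : ∀ᶠ t : ℝ in atTop, ∫ v in (0 : ℝ)..1, (√(1 - v))⁻¹ * (√t * p (t * v)) =
      ∫ s in (0 : ℝ)..t, (√(t - s))⁻¹ * p s := by
    filter_upwards [eventually_gt_atTop 0] with t ht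
    have := intervalIntegral.mul_integral_comp_mul_left (a := 0) (b := 1)
      (f := fun s => (√(t - s))⁻¹ * p s) t
    rw [mul_zero, mul_one] at this
    rw [← this, ← intervalIntegral.integral_const_mul]
    refine intervalIntegral.integral_congr fun v _ => ?_
    rw [show t - t * v = t * (1 - v) by ring, Real.sqrt_mul ht.le]
    have h2 : t * (√t)⁻¹ = √t := by rw [← div_eq_mul_inv, Real.div_sqrt]
    rw [mul_inv]
    linear_combination (-(√(1 - v))⁻¹ * p (t * v)) * h2
  refine Tendsto.congr' hrep ?_
  have hlim : c * π = ∫ v in (0 : ℝ)..1, (√(1 - v))⁻¹ * (c * (√v)⁻¹) := by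
    rw [← integral_abelKernel zero_lt_one, ← intervalIntegral.integral_const_mul]
    refine intervalIntegral.integral_congr fun v _ => ?_
    ring
  rw [hlim]
  refine intervalIntegral.tendsto_integral_filter_of_dominated_convergence
    (fun v => C * ((√(1 - v))⁻¹ * (√v)⁻¹)) ?_ ?_
    ((intervalIntegrable_abelKernel zero_lt_one).const_mul C) ?_
  · refine Eventually.of_forall fun t => Measurable.aestronglyMeasurable ?_
    have := hp.cont.measurable
    fun_prop
  · filter_upwards [eventually_gt_atTop 0] with t ht
    refine ae_of_all _ fun v hv => ?_
    rw [uIoc_of_le zero_le_one] at hv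
    have hv0 := hv.1
    have h1 := hp.nonneg (t * v) (by positivity)
    rw [Real.norm_eq_abs, abs_of_nonneg (by positivity)]
    calc (√(1 - v))⁻¹ * (√t * p (t * v)) ≤ (√(1 - v))⁻¹ * (√t * (C * (√(t * v))⁻¹)) := by
          gcongr; exact hC _ (by positivity)
      _ = _ := by
          rw [Real.sqrt_mul ht.le]
          have hs := Real.sqrt_pos.mpr ht
          field_simp
  · refine ae_of_all _ fun v hv => ?_
    rw [uIoc_of_le zero_le_one] at hv
    refine Tendsto.const_mul _ ?_
    have h := (hp.tendsto.comp (tendsto_id.atTop_mul_const hv.1)).mul_const (√v)⁻¹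
    refine h.congr' ?_
    filter_upwards [eventually_gt_atTop 0] with t ht
    simp only [Function.comp, id]
    rw [Real.sqrt_mul ht.le]
    have hs := Real.sqrt_pos.mpr hv.1
    field_simp

end SqrtDecay

end AbelKernel

section VolterraSolution

open Filter Topology MeasureTheory Set

/-- The source term `γ e^{-α f}`. -/
noncomputable def expSource (γ α : ℝ) (f : ℝ → ℝ) (s : ℝ) : ℝ := γ * Real.exp (-(α * f s))

/-- Nondecreasing solutions of the Volterra equation `f = p * (γ e^{-α f})`. -/
structure MonotoneVolterraSolution (p f : ℝ → ℝ) (γ α : ℝ) : Prop where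
  gamma_pos : 0 < γ
  alpha_pos : 0 < α
  cont : Continuous f
  nonneg : ∀ t ≥ 0, 0 ≤ f t
  mono : MonotoneOn f (Ici 0)
  eq : ∀ t ≥ 0, f t = ∫ s in (0 : ℝ)..t, p (t - s) * expSource γ α f s

lemma abs_integral_volterra_le {h u : ℝ → ℝ} {M γ δ T : ℝ} (hM : 0 ≤ M) (hT : 0 ≤ T)
    (hδ : 0 ≤ δ) (hu : Continuous u) (hu0 : ∀ s ≥ 0, 0 ≤ u s) (huγ : ∀ s ≥ 0, u s ≤ γ)
    (hhM : ∀ r > 0, |h r| ≤ M) (hhδ : ∀ r ≥ T, |h r| ≤ δ) {t : ℝ} (ht : 0 ≤ t)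
    (hint : IntervalIntegrable (fun s => h (t - s) * u s) volume 0 t) :
    |∫ s in (0 : ℝ)..t, h (t - s) * u s| ≤ δ * (∫ s in (0 : ℝ)..t, u s) + M * γ * T := by
  have hγ : 0 ≤ γ := (hu0 0 le_rfl).trans (huγ 0 le_rfl)
  set m := max (t - T) 0 with hm
  have hm0 : 0 ≤ m := le_max_right _ _
  have hmt : m ≤ t := max_le (by linarith) ht
  have hi1 : IntervalIntegrable (fun s => h (t - s) * u s) volume 0 m :=
    hint.mono_set (by rw [uIcc_of_le hm0, uIcc_of_le ht]; exact Icc_subset_Icc_right hmt)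
  have hi2 : IntervalIntegrable (fun s => h (t - s) * u s) volume m t :=
    hint.mono_set (by rw [uIcc_of_le hmt, uIcc_of_le ht]; exact Icc_subset_Icc_left hm0)
  rw [← intervalIntegral.integral_add_adjacent_intervals hi1 hi2]
  refine (abs_add_le _ _).trans (add_le_add ?_ ?_)
  · have h1 : |∫ s in (0 : ℝ)..m, h (t - s) * u s| ≤ ∫ s in (0 : ℝ)..m, δ * u s := by
      rw [← Real.norm_eq_abs]
      refine intervalIntegral.norm_integral_le_of_norm_le hm0 (ae_of_all _ fun s hs => ?_)
        ((hu.const_mul δ).intervalIntegrable _ _)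
      have hs2 : s ≤ t - T := by
        have := hs.2
        rcases le_max_iff.mp this with h | h
        · exact h
        · linarith [hs.1]
      rw [Real.norm_eq_abs, abs_mul, abs_of_nonneg (hu0 s hs.1.le)]
      exact mul_le_mul_of_nonneg_right (hhδ _ (by linarith)) (hu0 s hs.1.le)
    refine h1.trans ?_
    rw [intervalIntegral.integral_const_mul]
    refine mul_le_mul_of_nonneg_left ?_ hδ
    rw [← intervalIntegral.integral_add_adjacent_intervals (hu.intervalIntegrable 0 m)
      (hu.intervalIntegrable m t)]
    exact le_add_of_nonneg_right
      (intervalIntegral.integral_nonneg hmt fun s hs => hu0 s (hm0.trans hs.1))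
  · have h2 : |∫ s in m..t, h (t - s) * u s| ≤ ∫ s in m..t, M * γ := by
      rw [← Real.norm_eq_abs]
      have hne : ∀ᵐ s : ℝ, s ≠ t := by simp [ae_iff]
      refine intervalIntegral.norm_integral_le_of_norm_le hmt
        (hne.mono fun s hst hs => ?_) (by simp)
      have hs0 : 0 ≤ s := hm0.trans hs.1.le
      rw [Real.norm_eq_abs, abs_mul, abs_of_nonneg (hu0 s hs0)]
      exact mul_le_mul (hhM _ (sub_pos.mpr (lt_of_le_of_ne hs.2 hst))) (huγ s hs0)
        (hu0 s hs0) hM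
    refine h2.trans ?_
    rw [intervalIntegral.integral_const, smul_eq_mul, mul_comm]
    refine mul_le_mul_of_nonneg_left ?_ (by positivity)
    linarith [le_max_left (t - T) 0]

namespace MonotoneVolterraSolution

variable {p f : ℝ → ℝ} {c γ α : ℝ}

lemma continuous_source (h : MonotoneVolterraSolution p f γ α) :
    Continuous (expSource γ α f) := by
  have := h.cont
  unfold expSource
  fun_prop

lemma source_pos (h : MonotoneVolterraSolution p f γ α) (s : ℝ) : 0 < expSource γ α f s :=
  mul_pos h.gamma_pos (Real.exp_pos _)

lemma source_le (h : MonotoneVolterraSolution p f γ α) {s : ℝ} (hs : 0 ≤ s) :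
    expSource γ α f s ≤ γ :=
  mul_le_of_le_one_right h.gamma_pos.le
    (Real.exp_le_one_iff.mpr (neg_nonpos.mpr (mul_nonneg h.alpha_pos.le (h.nonneg s hs))))

lemma source_anti (h : MonotoneVolterraSolution p f γ α) {s t : ℝ} (hs : 0 ≤ s) (hst : s ≤ t) :
    expSource γ α f t ≤ expSource γ α f s := by
  have h1 := h.mono (show s ∈ Ici 0 from hs) (show t ∈ Ici 0 from hs.trans hst) hst
  have h2 := h.alpha_pos
  have h3 := h.gamma_pos
  unfold expSource
  gcongr

lemma continuous_integrand (h : MonotoneVolterraSolution p f γ α) (hp : SqrtDecay p c) (t : ℝ) :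
    Continuous fun s => p (t - s) * expSource γ α f s := by
  have := hp.cont
  have := h.continuous_source
  fun_prop

lemma eventually_lower_source (h : MonotoneVolterraSolution p f γ α) (hp : SqrtDecay p c) :
    ∃ K > 0, ∀ᶠ t in atTop, K * √t ≤ f t * Real.exp (α * f t) := by
  obtain ⟨T, hT0, hT⟩ := hp.eventually_lower
  have hc := hp.pos
  have hγ := h.gamma_pos
  refine ⟨γ * c / 4, by positivity, ?_⟩
  filter_upwards [eventually_ge_atTop (2 * T)] with t ht
  have ht0 : 0 < t := by linarith
  have hi := h.continuous_integrand hp t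
  have h1 : ∫ s in (0 : ℝ)..(t / 2), c / 2 * (√t)⁻¹ * expSource γ α f t ≤ f t := by
    rw [h.eq t ht0.le, ← intervalIntegral.integral_add_adjacent_intervals
      (hi.intervalIntegrable 0 (t / 2)) (hi.intervalIntegrable (t / 2) t)]
    refine le_add_of_le_of_nonneg ?_ ?_
    · refine intervalIntegral.integral_mono_on (by linarith) (by simp)
        (hi.intervalIntegrable _ _) fun s hs => ?_
      refine mul_le_mul ?_ (h.source_anti hs.1 (by linarith [hs.2])) (h.source_pos t).le
        (hp.nonneg _ (by linarith [hs.2]))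
      refine le_trans ?_ (hT (t - s) (by linarith [hs.2]))
      have h2 : 0 < t - s := by linarith [hs.2]
      have : √(t - s) ≤ √t := Real.sqrt_le_sqrt (by linarith [hs.1])
      have h3 := Real.sqrt_pos.mpr h2
      gcongr
    · exact intervalIntegral.integral_nonneg (by linarith) fun s hs =>
        mul_nonneg (hp.nonneg _ (by linarith [hs.2])) (h.source_pos s).le
  rw [intervalIntegral.integral_const, smul_eq_mul, sub_zero] at h1
  have h2 := mul_le_mul_of_nonneg_right h1 (Real.exp_pos (α * f t)).le
  refine le_trans (le_of_eq ?_) h2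
  have h3 : t * (√t)⁻¹ = √t := by rw [← div_eq_mul_inv, Real.div_sqrt]
  have h4 : expSource γ α f t * Real.exp (α * f t) = γ := by
    rw [expSource, mul_assoc, ← Real.exp_add]; simp
  linear_combination (-(γ * c / 4)) * h3 - (t * (√t)⁻¹ * c / 4) * h4

lemma eventually_lower_log (h : MonotoneVolterraSolution p f γ α) (hp : SqrtDecay p c)
    {B : ℝ} (hB0 : 0 < B) (hB : α * B < 1 / 2) : ∀ᶠ t in atTop, B * Real.log t ≤ f t := by
  obtain ⟨K, hK, hev⟩ := h.eventually_lower_source hp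
  have hα := h.alpha_pos
  have hlog := (isLittleO_log_rpow_atTop (r := 1 / 2 - α * B) (by linarith)).bound
    (show 0 < K / (2 * B) by positivity)
  filter_upwards [hev, hlog, eventually_gt_atTop 1] with t h1 h2 ht
  have ht0 : 0 < t := by linarith
  by_contra! hlt
  have hlogpos := Real.log_pos ht
  rw [Real.norm_eq_abs, Real.norm_eq_abs, abs_of_pos hlogpos,
    abs_of_pos (Real.rpow_pos_of_pos ht0 _)] at h2
  have h3 : f t * Real.exp (α * f t) ≤ B * Real.log t * t ^ (α * B) := by
    have : Real.exp (α * f t) ≤ t ^ (α * B) := by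
      rw [Real.rpow_def_of_pos ht0, Real.exp_le_exp]
      nlinarith
    exact mul_le_mul hlt.le this (Real.exp_pos _).le (by positivity)
  have h4 : B * Real.log t * t ^ (α * B) ≤ K / 2 * √t := by
    calc B * Real.log t * t ^ (α * B)
        ≤ B * (K / (2 * B) * t ^ (1 / 2 - α * B)) * t ^ (α * B) := by gcongr
      _ = K / 2 * (t ^ (1 / 2 - α * B) * t ^ (α * B)) := by field_simp
      _ = K / 2 * √t := by
        rw [← Real.rpow_add ht0, Real.sqrt_eq_rpow]; ring_nf
  have := Real.sqrt_pos.mpr ht0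
  nlinarith

lemma upper_log (h : MonotoneVolterraSolution p f γ α) (hp : SqrtDecay p c)
    {ε : ℝ} (hε : 0 < ε) :
    ∃ K, ∀ t ≥ 0, f t ≤ (1 + ε) * (1 / (2 * α) * Real.log (1 + t)) + K := by
  obtain ⟨T, hT0, hT⟩ := hp.almost_antitone hε
  obtain ⟨C, hC0, hC⟩ := hp.exists_bound
  have hα := h.alpha_pos
  have hγ := h.gamma_pos
  refine ⟨γ * T + C * γ * π, fun t ht => ?_⟩
  have hcont := h.cont
  have hcomp : IsCompact {s ∈ Icc 0 t | f s ≤ 1 / (2 * α) * Real.log (1 + s)} := by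
    refine isCompact_Icc.of_isClosed_subset ?_ (fun s hs => hs.1)
    have hlog : ContinuousOn (fun s => 1 / (2 * α) * Real.log (1 + s)) (Icc 0 t) := by
      refine continuousOn_const.mul (ContinuousOn.log (by fun_prop) fun s hs => ?_)
      linarith [hs.1]
    exact isClosed_Icc.isClosed_le hcont.continuousOn hlog
  have hf0 : f 0 = 0 := by rw [h.eq 0 le_rfl, intervalIntegral.integral_same]
  obtain ⟨t₀, ⟨ht₀, hft₀⟩, hmax⟩ := hcomp.exists_isGreatest
    ⟨0, ⟨le_rfl, ht⟩, by simp [hf0]⟩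
  have hi (r : ℝ) := h.continuous_integrand hp r
  have hlarge : ∀ s ∈ Ioo t₀ t, expSource γ α f s ≤ γ * (√s)⁻¹ := by
    intro s hs
    have hs0 : 0 < s := ht₀.1.trans_lt hs.1
    have h1 : 1 / (2 * α) * Real.log (1 + s) < f s := by
      by_contra! hle
      exact absurd (hmax ⟨⟨hs0.le, hs.2.le⟩, hle⟩) (not_le.mpr hs.1)
    have h2 : Real.log s ≤ Real.log (1 + s) := Real.log_le_log hs0 (by linarith)
    unfold expSource
    refine mul_le_mul_of_nonneg_left ?_ hγ.le
    rw [Real.sqrt_eq_rpow, ← Real.rpow_neg hs0.le, Real.rpow_def_of_pos hs0, Real.exp_le_exp]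
    have h3 := mul_lt_mul_of_pos_left h1 hα
    have h4 : α * (1 / (2 * α) * Real.log (1 + s)) = Real.log (1 + s) / 2 := by field_simp
    linarith
  set m := max (t₀ - T) 0 with hm
  have hm0 : 0 ≤ m := le_max_right _ _
  have hmt₀ : m ≤ t₀ := max_le (by linarith) ht₀.1
  have hpart1 : ∫ s in (0 : ℝ)..m, p (t - s) * expSource γ α f s ≤ (1 + ε) * f t₀ := by
    have h1 : ∫ s in (0 : ℝ)..m, p (t - s) * expSource γ α f s ≤
        ∫ s in (0 : ℝ)..m, (1 + ε) * (p (t₀ - s) * expSource γ α f s) := by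
      refine intervalIntegral.integral_mono_on_of_le_Ioo hm0 ((hi t).intervalIntegrable _ _)
        (((hi t₀).const_mul (1 + ε)).intervalIntegrable _ _) fun s hs => ?_
      have hs2 : s < t₀ - T := by
        rcases lt_max_iff.mp hs.2 with h | h
        · exact h
        · linarith [hs.1]
      rw [← mul_assoc]
      exact mul_le_mul_of_nonneg_right (hT _ (by linarith) _ (by linarith [ht₀.2]))
        (h.source_pos s).le
    refine h1.trans ?_
    rw [intervalIntegral.integral_const_mul]
    refine mul_le_mul_of_nonneg_left ?_ (by linarith)
    rw [h.eq t₀ ht₀.1, ← intervalIntegral.integral_add_adjacent_intervals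
      ((hi t₀).intervalIntegrable 0 m) ((hi t₀).intervalIntegrable m t₀)]
    exact le_add_of_nonneg_right (intervalIntegral.integral_nonneg hmt₀ fun s hs =>
      mul_nonneg (hp.nonneg _ (by linarith [hs.2])) (h.source_pos s).le)
  have hpart2 : ∫ s in m..t₀, p (t - s) * expSource γ α f s ≤ γ * T := by
    have h1 : ∫ s in m..t₀, p (t - s) * expSource γ α f s ≤ ∫ s in m..t₀, γ := by
      refine intervalIntegral.integral_mono_on hmt₀ ((hi t).intervalIntegrable _ _)
        (by simp) fun s hs => ?_
      have hts : 0 ≤ t - s := by linarith [hs.2, ht₀.2]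
      calc p (t - s) * expSource γ α f s ≤ 1 * γ :=
            mul_le_mul (hp.le_one _ hts) (h.source_le (hm0.trans hs.1)) (h.source_pos s).le
              zero_le_one
        _ = γ := one_mul γ
    refine h1.trans ?_
    rw [intervalIntegral.integral_const, smul_eq_mul, mul_comm]
    refine mul_le_mul_of_nonneg_left ?_ hγ.le
    linarith [le_max_left (t₀ - T) 0]
  have hpart3 : ∫ s in t₀..t, p (t - s) * expSource γ α f s ≤ C * γ * π := by
    rcases ht.eq_or_lt with rfl | htpos
    · have : t₀ = 0 := le_antisymm ht₀.2 ht₀.1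
      rw [this, intervalIntegral.integral_same]; positivity
    have hA := intervalIntegrable_abelKernel htpos
    have hA0 : IntervalIntegrable (fun s => (√(t - s))⁻¹ * (√s)⁻¹) volume 0 t₀ :=
      hA.mono_set (by rw [uIcc_of_le ht₀.1, uIcc_of_le ht]; exact Icc_subset_Icc_right ht₀.2)
    have hA1 : IntervalIntegrable (fun s => (√(t - s))⁻¹ * (√s)⁻¹) volume t₀ t :=
      hA.mono_set (by rw [uIcc_of_le ht₀.2, uIcc_of_le ht]; exact Icc_subset_Icc_left ht₀.1)
    have h1 : ∫ s in t₀..t, p (t - s) * expSource γ α f s ≤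
        ∫ s in t₀..t, C * γ * ((√(t - s))⁻¹ * (√s)⁻¹) := by
      refine intervalIntegral.integral_mono_on_of_le_Ioo ht₀.2 ((hi t).intervalIntegrable _ _)
        (hA1.const_mul _) fun s hs => ?_
      calc p (t - s) * expSource γ α f s ≤ (C * (√(t - s))⁻¹) * (γ * (√s)⁻¹) :=
            mul_le_mul (hC _ (by linarith [hs.2])) (hlarge s hs) (h.source_pos s).le
              (by positivity)
        _ = _ := by ring
    refine h1.trans ?_
    rw [intervalIntegral.integral_const_mul]
    refine mul_le_mul_of_nonneg_left ?_ (by positivity)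
    rw [← integral_abelKernel htpos, ← intervalIntegral.integral_add_adjacent_intervals hA0 hA1]
    exact le_add_of_nonneg_left
      (intervalIntegral.integral_nonneg ht₀.1 fun s _ => by positivity)
  have hsplit : f t = (∫ s in (0 : ℝ)..m, p (t - s) * expSource γ α f s) +
      (∫ s in m..t₀, p (t - s) * expSource γ α f s) +
      ∫ s in t₀..t, p (t - s) * expSource γ α f s := by
    rw [h.eq t ht, intervalIntegral.integral_add_adjacent_intervals
      ((hi t).intervalIntegrable _ _) ((hi t).intervalIntegrable _ _),
      intervalIntegral.integral_add_adjacent_intervals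
      ((hi t).intervalIntegrable _ _) ((hi t).intervalIntegrable _ _)]
  have hlast : (1 + ε) * f t₀ ≤ (1 + ε) * (1 / (2 * α) * Real.log (1 + t)) := by
    refine mul_le_mul_of_nonneg_left (hft₀.trans ?_) (by linarith)
    refine mul_le_mul_of_nonneg_left ?_ (by positivity)
    exact Real.log_le_log (by linarith [ht₀.1]) (by linarith [ht₀.2])
  linarith

lemma tendsto_div_log (h : MonotoneVolterraSolution p f γ α) (hp : SqrtDecay p c) :
    Tendsto (fun t => f t / Real.log t) atTop (𝓝 (1 / (2 * α))) := by
  have hα := h.alpha_pos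
  refine tendsto_order.mpr ⟨fun b hb => ?_, fun b hb => ?_⟩
  · obtain ⟨B, hB1, hB2⟩ := exists_between (max_lt hb (show 0 < 1 / (2 * α) by positivity))
    have hB0 : 0 < B := (le_max_right _ _).trans_lt hB1
    rw [lt_div_iff₀ (by positivity)] at hB2
    filter_upwards [h.eventually_lower_log hp hB0 (by linarith), eventually_gt_atTop 1]
      with t h1 ht
    rw [lt_div_iff₀ (Real.log_pos ht)]
    have := mul_lt_mul_of_pos_right ((le_max_left b 0).trans_lt hB1) (Real.log_pos ht)
    linarith
  · set ε := (b * (2 * α) - 1) / 2 with hε_def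
    have hε : 0 < ε := by
      rw [gt_iff_lt, div_lt_iff₀ (by positivity)] at hb
      rw [hε_def]; linarith
    obtain ⟨K, hK⟩ := h.upper_log hp hε
    have hδ : 0 < b - (1 + ε) * (1 / (2 * α)) := by
      rw [gt_iff_lt, div_lt_iff₀ (by positivity)] at hb
      have : b - (1 + ε) * (1 / (2 * α)) = (b * (2 * α) - 1) / (2 * (2 * α)) := by
        rw [hε_def]; field_simp; ring
      rw [this]
      exact div_pos (by linarith) (by positivity)
    have hlog := Real.tendsto_log_atTop.eventually_gt_atTop
      ((K + (1 + ε) * (1 / (2 * α) * Real.log 2)) / (b - (1 + ε) * (1 / (2 * α))))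
    filter_upwards [hlog, eventually_gt_atTop 1] with t h1 ht
    rw [div_lt_iff₀ (Real.log_pos ht)]
    rw [div_lt_iff₀ hδ] at h1
    refine (hK t (by linarith)).trans_lt ?_
    have h2 : Real.log (1 + t) ≤ Real.log 2 + Real.log t := by
      rw [← Real.log_mul (by norm_num) (by linarith)]
      exact Real.log_le_log (by linarith) (by linarith)
    have h3 : (1 + ε) * (1 / (2 * α) * Real.log (1 + t)) ≤
        (1 + ε) * (1 / (2 * α) * (Real.log 2 + Real.log t)) := by gcongr
    linarith

end MonotoneVolterraSolution

end VolterraSolution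

section VolterraAsymptotics

open Filter Topology MeasureTheory Set

/-- A monotone density theorem at the scale `√t * log t`. -/
lemma tendsto_density_of_tendsto_integral {u : ℝ → ℝ} {l : ℝ} (hu : Continuous u)
    (hanti : AntitoneOn u (Ici 0))
    (hU : Tendsto (fun t => (∫ s in (0 : ℝ)..t, u s) / (√t * Real.log t)) atTop (𝓝 l)) :
    Tendsto (fun t => u t * √t / Real.log t) atTop (𝓝 (l / 2)) := by
  have hscale : ∀ b > 0, Tendsto (fun t => ((∫ s in t..(t * b), u s)) / (√t * Real.log t)) atTop
      (𝓝 (l * √b - l)) := by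
    intro b hb
    have hratio : Tendsto (fun t => 1 + Real.log b * (Real.log t)⁻¹) atTop (𝓝 1) := by
      simpa using (Real.tendsto_log_atTop.inv_tendsto_atTop.const_mul (Real.log b)).const_add 1
    have h := (((hU.comp (tendsto_id.atTop_mul_const hb)).mul_const (√b)).mul hratio).sub hU
    rw [mul_one] at h
    refine h.congr' ?_
    filter_upwards [eventually_gt_atTop 1, eventually_gt_atTop (1 / b)] with t ht htb
    rw [div_lt_iff₀ hb] at htb
    have h1 := Real.log_pos ht
    have h2 : 0 < Real.log t + Real.log b := by
      rw [← Real.log_mul (by positivity) hb.ne']; exact Real.log_pos htb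
    have h3 : 0 < √t := Real.sqrt_pos.mpr (by linarith)
    have h4 : 0 < √b := Real.sqrt_pos.mpr hb
    simp only [Function.comp, id]
    rw [← intervalIntegral.integral_add_adjacent_intervals (hu.intervalIntegrable 0 t)
      (hu.intervalIntegrable t (t * b)), Real.sqrt_mul (by linarith),
      Real.log_mul (by positivity) hb.ne']
    field_simp
    ring
  have hslope : ∀ b > 0, b ≠ 1 → Tendsto
      (fun t => ((∫ s in t..(t * b), u s)) / (√t * Real.log t) / (b - 1)) atTop
      (𝓝 (l / (√b + 1))) := by
    intro b hb hb1
    have h := (hscale b hb).div_const (b - 1)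
    have h1 : (√b - 1) * (√b + 1) = b - 1 := by nlinarith [Real.sq_sqrt hb.le]
    have h2 : b - 1 ≠ 0 := sub_ne_zero.mpr hb1
    have h3 : √b + 1 ≠ 0 := by positivity
    convert h using 2
    rw [div_eq_div_iff h3 h2]
    linear_combination (-l) * h1
  have hlim : Tendsto (fun b => l / (√b + 1)) (𝓝 1) (𝓝 (l / 2)) := by
    have : ContinuousAt (fun b : ℝ => l / (√b + 1)) 1 := by
      refine ContinuousAt.div continuousAt_const (by fun_prop) (by simp)
    have h := this.tendsto
    norm_num at h
    exact h
  have hrw : ∀ t > 1, ∀ b ≠ 1, u t * √t / Real.log t =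
      (t * b - t) * u t / (√t * Real.log t) / (b - 1) := by
    intro t ht b hb
    have h1 := Real.log_pos ht
    have h3 : 0 < √t := Real.sqrt_pos.mpr (by linarith)
    have h2 : b - 1 ≠ 0 := sub_ne_zero.mpr hb
    field_simp
    rw [Real.sq_sqrt (by linarith)]
  refine tendsto_order.mpr ⟨fun y hy => ?_, fun y hy => ?_⟩
  · obtain ⟨b, hby, hb⟩ := (((hlim.eventually_const_lt hy).filter_mono nhdsWithin_le_nhds).and
      (self_mem_nhdsWithin (s := Ioi 1))).exists
    have hb : 1 < b := hb
    filter_upwards [(hslope b (by linarith) hb.ne').eventually_const_lt hby,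
      eventually_gt_atTop 1] with t h1 ht
    refine h1.trans_le ?_
    rw [hrw t ht b hb.ne']
    have hlog := Real.log_pos ht
    have hb' : 0 < b - 1 := by linarith
    have htb : t ≤ t * b := by nlinarith
    gcongr
    calc ∫ s in t..(t * b), u s ≤ ∫ s in t..(t * b), u t :=
          intervalIntegral.integral_mono_on htb (hu.intervalIntegrable _ _) (by simp)
            fun s hs => hanti (show (0 : ℝ) ≤ t by linarith)
              (show (0 : ℝ) ≤ s by linarith [hs.1]) hs.1
      _ = _ := by rw [intervalIntegral.integral_const, smul_eq_mul]
  · obtain ⟨b, ⟨hby, hb0⟩, hb⟩ := ((((hlim.eventually_lt_const hy).and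
      (eventually_gt_nhds zero_lt_one)).filter_mono nhdsWithin_le_nhds).and
      (self_mem_nhdsWithin (s := Iio 1))).exists
    have hb : b < 1 := hb
    filter_upwards [(hslope b hb0 hb.ne).eventually_lt_const hby,
      eventually_gt_atTop 1] with t h1 ht
    refine lt_of_le_of_lt ?_ h1
    rw [hrw t ht b hb.ne]
    have hlog := Real.log_pos ht
    have hb' : b - 1 ≤ 0 := by linarith
    have htb : t * b ≤ t := by nlinarith
    refine div_le_div_of_nonpos_of_le hb' ?_
    gcongr
    rw [intervalIntegral.integral_symm]
    have : ∫ s in (t * b)..t, u t ≤ ∫ s in (t * b)..t, u s :=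
      intervalIntegral.integral_mono_on htb (by simp) (hu.intervalIntegrable _ _)
        fun s hs => hanti (show (0 : ℝ) ≤ s from (by positivity : 0 ≤ t * b).trans hs.1)
          (show (0 : ℝ) ≤ t by linarith) hs.2
    rw [intervalIntegral.integral_const, smul_eq_mul] at this
    linarith

namespace MonotoneVolterraSolution

variable {p f : ℝ → ℝ} {c γ α : ℝ}

lemma abel_eq (h : MonotoneVolterraSolution p f γ α) (hp : SqrtDecay p c) {t : ℝ} (ht : 0 ≤ t) :
    ∫ s in (0 : ℝ)..t, (√(t - s))⁻¹ * f s = ∫ s in (0 : ℝ)..t,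
      (∫ r in (0 : ℝ)..(t - s), (√(t - s - r))⁻¹ * p r) * expSource γ α f s := by
  have hkm : Measurable fun x : ℝ => (√x)⁻¹ := by fun_prop
  rw [← volterra_assoc (k := fun x => (√x)⁻¹) (g := p) (fun x hx => by positivity)
    (fun x hx => hp.nonneg x (le_of_lt hx)) (fun x _ => (h.source_pos x).le) hkm.aemeasurable
    hp.cont.measurable.aemeasurable h.continuous_source.measurable.aemeasurable
    (fun r hr => hp.intervalIntegrable_abel hr)
    (fun r _ => (h.continuous_integrand hp r).intervalIntegrable _ _) ht]
  refine intervalIntegral.integral_congr fun s hs => ?_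
  rw [uIcc_of_le ht] at hs
  rw [← h.eq s hs.1]

lemma tendsto_abel (h : MonotoneVolterraSolution p f γ α) (hp : SqrtDecay p c) :
    Tendsto (fun t => (∫ s in (0 : ℝ)..t, (√(t - s))⁻¹ * f s) / (√t * Real.log t)) atTop
      (𝓝 (1 / α)) := by
  have hα := h.alpha_pos
  have hrep : ∀ᶠ t : ℝ in atTop, ∫ v in (0 : ℝ)..1, (√(1 - v))⁻¹ * (f (t * v) / Real.log t) =
      (∫ s in (0 : ℝ)..t, (√(t - s))⁻¹ * f s) / (√t * Real.log t) := by
    filter_upwards [eventually_gt_atTop 1] with t ht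
    have := intervalIntegral.mul_integral_comp_mul_left (a := 0) (b := 1)
      (f := fun s => (√(t - s))⁻¹ * f s) t
    rw [mul_zero, mul_one] at this
    rw [← this, ← intervalIntegral.integral_const_mul, ← intervalIntegral.integral_div]
    refine intervalIntegral.integral_congr fun v _ => ?_
    have hs : 0 < √t := Real.sqrt_pos.mpr (by linarith)
    have hl := Real.log_pos ht
    rw [show t - t * v = t * (1 - v) by ring, Real.sqrt_mul (by linarith), mul_inv]
    have h2 : t = √t * √t := (Real.mul_self_sqrt (by linarith)).symm
    rw [eq_div_iff (by positivity)]
    have h3 : f (t * v) / Real.log t * Real.log t = f (t * v) := div_mul_cancel₀ _ hl.ne'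
    have h4 : t * (√t)⁻¹ = √t := by rw [← div_eq_mul_inv, Real.div_sqrt]
    linear_combination ((√(1 - v))⁻¹ * √t) * h3 - ((√(1 - v))⁻¹ * f (t * v)) * h4
  refine Tendsto.congr' hrep ?_
  have hlim : 1 / α = ∫ v in (0 : ℝ)..1, (√(1 - v))⁻¹ * (1 / (2 * α)) := by
    rw [intervalIntegral.integral_mul_const, integral_inv_sqrt_one_sub]
    field_simp
  rw [hlim]
  have hdiv := h.tendsto_div_log hp
  refine intervalIntegral.tendsto_integral_filter_of_dominated_convergence
    (fun v => (√(1 - v))⁻¹ * (1 / (2 * α) + 1)) ?_ ?_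
    ((intervalIntegrable_inv_sqrt_sub zero_lt_one).mul_const _) ?_
  · refine Eventually.of_forall fun t => Measurable.aestronglyMeasurable ?_
    have := h.cont.measurable
    fun_prop
  · filter_upwards [eventually_gt_atTop 1,
      hdiv.eventually_le_const (lt_add_one (1 / (2 * α)))] with t ht hft
    refine ae_of_all _ fun v hv => ?_
    rw [uIoc_of_le zero_le_one] at hv
    have hl := Real.log_pos ht
    have h0 : 0 ≤ t * v := mul_nonneg (by linarith) hv.1.le
    have h1 := h.nonneg (t * v) h0
    rw [Real.norm_eq_abs, abs_of_nonneg (by positivity)]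
    refine mul_le_mul_of_nonneg_left (le_trans ?_ hft) (by positivity)
    have h2 : t * v ≤ t := mul_le_of_le_one_right (by linarith) hv.2
    have h3 := h.mono (show t * v ∈ Ici 0 from h0) (show (0 : ℝ) ≤ t by linarith) h2
    gcongr
  · refine ae_of_all _ fun v hv => ?_
    rw [uIoc_of_le zero_le_one] at hv
    refine Tendsto.const_mul _ ?_
    have hratio : Tendsto (fun t => 1 + Real.log v * (Real.log t)⁻¹) atTop (𝓝 1) := by
      simpa using (Real.tendsto_log_atTop.inv_tendsto_atTop.const_mul (Real.log v)).const_add 1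
    have h1 := (hdiv.comp (tendsto_id.atTop_mul_const hv.1)).mul hratio
    rw [mul_one] at h1
    refine h1.congr' ?_
    filter_upwards [eventually_gt_atTop 1, eventually_gt_atTop (1 / v)] with t ht htv
    rw [div_lt_iff₀ hv.1] at htv
    have hl := Real.log_pos ht
    have h2 : 0 < Real.log t + Real.log v := by
      rw [← Real.log_mul (by positivity) hv.1.ne']; exact Real.log_pos htv
    simp only [Function.comp, id]
    rw [Real.log_mul (by positivity) hv.1.ne']
    field_simp

lemma abs_abel_sub_le (h : MonotoneVolterraSolution p f γ α) (hp : SqrtDecay p c) {δ : ℝ}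
    (hδ : 0 < δ) : ∃ K, ∀ t > 0, |(∫ s in (0 : ℝ)..t, (√(t - s))⁻¹ * f s) -
      c * π * ∫ s in (0 : ℝ)..t, expSource γ α f s| ≤
        δ * (∫ s in (0 : ℝ)..t, expSource γ α f s) + K := by
  obtain ⟨C, hC0, hC⟩ := hp.exists_bound
  have hc := hp.pos
  obtain ⟨T, hT⟩ := eventually_atTop.mp
    ((Metric.tendsto_nhds.mp hp.abel_tendsto δ hδ).and (eventually_ge_atTop 0))
  have hT0 : 0 ≤ T := (hT T le_rfl).2
  refine ⟨(C * π + c * π) * γ * T, fun t ht => ?_⟩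
  set R : ℝ → ℝ := fun r => ∫ s in (0 : ℝ)..r, (√(r - s))⁻¹ * p s with hR
  have hR0 : ∀ r > 0, 0 ≤ R r := fun r hr =>
    volterra_nonneg (k := fun x => (√x)⁻¹) (fun x hx => hp.nonneg x (le_of_lt hx))
      (fun x _ => by positivity) hr
  have hRC : ∀ r > 0, R r ≤ C * π := fun r hr => hp.abel_bound hC hr
  have hRm : AEMeasurable R (volume.restrict (Ioi 0)) :=
    aemeasurable_volterra (k := fun x => (√x)⁻¹) (fun x hx => hp.nonneg x (le_of_lt hx))
      (fun x _ => by positivity) hp.cont.measurable.aemeasurable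
      (by fun_prop : Measurable fun x : ℝ => (√x)⁻¹).aemeasurable
  have hu := h.continuous_source
  have hRi : IntervalIntegrable (fun s => R (t - s)) volume 0 t := by
    rw [intervalIntegrable_iff_integrableOn_Ioo_of_le ht.le]
    refine Integrable.of_bound (aemeasurable_comp_const_sub hRm t).aestronglyMeasurable
      (C * π) ?_
    refine (ae_restrict_iff' measurableSet_Ioo).mpr (ae_of_all _ fun s hs => ?_)
    have hs' : 0 < t - s := sub_pos.mpr hs.2
    rw [Real.norm_eq_abs, abs_of_nonneg (hR0 _ hs')]
    exact hRC _ hs'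
  have hRu : IntervalIntegrable (fun s => R (t - s) * expSource γ α f s) volume 0 t :=
    hRi.mul_continuousOn hu.continuousOn
  have hcu : IntervalIntegrable (fun s => c * π * expSource γ α f s) volume 0 t :=
    (hu.const_mul _).intervalIntegrable _ _
  have hsub : (∫ s in (0 : ℝ)..t, (√(t - s))⁻¹ * f s) -
      c * π * ∫ s in (0 : ℝ)..t, expSource γ α f s =
        ∫ s in (0 : ℝ)..t, (R (t - s) - c * π) * expSource γ α f s := by
    rw [h.abel_eq hp ht.le, ← intervalIntegral.integral_const_mul,
      ← intervalIntegral.integral_sub hRu hcu]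
    refine intervalIntegral.integral_congr fun s _ => ?_
    simp only [hR]
    ring
  rw [hsub]
  refine abs_integral_volterra_le (h := fun r => R r - c * π) (by positivity) hT0 hδ.le hu
    (fun s _ => (h.source_pos s).le) (fun s hs => h.source_le hs) (fun r hr => ?_)
    (fun r hr => ?_) ht.le ?_
  · have h1 := hR0 r hr
    have h2 := hRC r hr
    have h3 : 0 < c * π := by positivity
    rw [abs_le]
    constructor <;> linarith
  · exact (hT r hr).1.le
  · refine (hRu.sub hcu).congr (fun s _ => ?_)
    ring

lemma tendsto_integral_source (h : MonotoneVolterraSolution p f γ α) (hp : SqrtDecay p c) :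
    Tendsto (fun t => (∫ s in (0 : ℝ)..t, expSource γ α f s) / (√t * Real.log t)) atTop
      (𝓝 (1 / (α * c * π))) := by
  have hα := h.alpha_pos
  have hc := hp.pos
  have hcπ : 0 < c * π := by positivity
  set N : ℝ → ℝ := fun t => √t * Real.log t
  set G : ℝ → ℝ := fun t => ∫ s in (0 : ℝ)..t, (√(t - s))⁻¹ * f s
  set U : ℝ → ℝ := fun t => ∫ s in (0 : ℝ)..t, expSource γ α f s
  have hG : Tendsto (fun t => G t / N t) atTop (𝓝 (1 / α)) := h.tendsto_abel hp
  have hN : Tendsto N atTop atTop := Real.tendsto_sqrt_atTop.atTop_mul_atTop₀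
    Real.tendsto_log_atTop
  have hbound : ∀ δ > 0, ∃ K, ∀ᶠ t in atTop,
      |G t / N t - c * π * (U t / N t)| ≤ δ * (U t / N t) + K / N t := by
    intro δ hδ
    obtain ⟨K, hK⟩ := h.abs_abel_sub_le hp hδ
    refine ⟨K, ?_⟩
    filter_upwards [eventually_gt_atTop 0, hN.eventually_gt_atTop 0] with t ht hNt
    have e : G t / N t - c * π * (U t / N t) = (G t - c * π * U t) / N t := by ring
    have e' : δ * (U t / N t) + K / N t = (δ * U t + K) / N t := by ring
    rw [e, e', abs_div, abs_of_pos hNt]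
    have := hK t ht
    gcongr
  have hKN : ∀ K : ℝ, Tendsto (fun t => K / N t) atTop (𝓝 0) := fun K => hN.const_div_atTop K
  obtain ⟨B, hB0, hB⟩ : ∃ B > 0, ∀ᶠ t in atTop, U t / N t ≤ B := by
    obtain ⟨K, hK⟩ := hbound (c * π / 2) (by positivity)
    have h1 : Tendsto (fun t => (G t / N t + K / N t) / (c * π / 2)) atTop
        (𝓝 ((1 / α + 0) / (c * π / 2))) := (hG.add (hKN K)).div_const _
    refine ⟨(1 / α + 0) / (c * π / 2) + 1, by positivity, ?_⟩
    filter_upwards [hK, h1.eventually_le_const (lt_add_one _)] with t h2 h3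
    refine le_trans ?_ h3
    rw [le_div_iff₀ (by positivity)]
    linarith [(abs_le.mp h2).1]
  have hdiff : Tendsto (fun t => G t / N t - c * π * (U t / N t)) atTop (𝓝 0) := by
    refine Metric.tendsto_nhds.mpr fun ε hε => ?_
    obtain ⟨K, hK⟩ := hbound (ε / (2 * B)) (by positivity)
    filter_upwards [hK, hB, (hKN K).eventually_lt_const (show 0 < ε / 2 by positivity)]
      with t h1 h2 h3
    rw [Real.dist_eq, sub_zero]
    have h4 : ε / (2 * B) * (U t / N t) ≤ ε / (2 * B) * B := by gcongr
    have h5 : ε / (2 * B) * B = ε / 2 := by field_simp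
    linarith
  have h1 := (hG.sub hdiff).div_const (c * π)
  have h2 : (1 / α - 0) / (c * π) = 1 / (α * c * π) := by rw [sub_zero]; field_simp
  rw [h2] at h1
  refine h1.congr fun t => ?_
  field_simp
  ring

lemma tendsto_source (h : MonotoneVolterraSolution p f γ α) (hp : SqrtDecay p c) :
    Tendsto (fun t => expSource γ α f t * √t / Real.log t) atTop
      (𝓝 (1 / (α * c * π) / 2)) :=
  tendsto_density_of_tendsto_integral h.continuous_source
    (fun _ hs _ _ hst => h.source_anti hs hst) (h.tendsto_integral_source hp)

lemma tendsto_sub_log (h : MonotoneVolterraSolution p f γ α) (hp : SqrtDecay p c) :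
    Tendsto (fun t => f t - (1 / α) * ((1 / 2) * Real.log t - Real.log (Real.log t) +
      Real.log (2 * α * c * π * γ))) atTop (𝓝 0) := by
  have hα := h.alpha_pos
  have hγ := h.gamma_pos
  have hc := hp.pos
  have hL : 0 < 1 / (α * c * π) / 2 := by positivity
  have h1 := (((Real.continuousAt_log hL.ne').tendsto.comp (h.tendsto_source hp)).sub_const
    (Real.log (1 / (α * c * π) / 2))).const_mul (-(1 / α))
  rw [sub_self, mul_zero] at h1
  refine h1.congr' ?_
  filter_upwards [eventually_gt_atTop 1] with t ht
  have hl := Real.log_pos ht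
  have hs : 0 < √t := Real.sqrt_pos.mpr (by linarith)
  have hu := h.source_pos t
  simp only [Function.comp]
  have e1 : Real.log (2 * α * c * π * γ) = Real.log γ - Real.log (1 / (α * c * π) / 2) := by
    rw [← Real.log_div hγ.ne' hL.ne']
    congr 1
    field_simp
  rw [e1, Real.log_div (by positivity) hl.ne', Real.log_mul hu.ne' hs.ne',
    Real.log_sqrt (by linarith), expSource, Real.log_mul hγ.ne' (Real.exp_pos _).ne',
    Real.log_exp]
  field_simp
  ring

end MonotoneVolterraSolution

end VolterraAsymptotics

section HeatKernelEquation

open Filter Topology MeasureTheory Set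

/-- The exponential generating function of a sequence. -/
noncomputable def expGen (b : ℕ → ℝ) (t : ℝ) : ℝ := ∑' n : ℕ, t ^ n / (n.factorial : ℝ) * b n

lemma hasSum_expGen {b : ℕ → ℝ} (hb : ∀ n, |b n| ≤ 1) (t : ℝ) :
    HasSum (fun n : ℕ => t ^ n / (n.factorial : ℝ) * b n) (expGen b t) := by
  refine Summable.hasSum (Summable.of_norm_bounded (Real.summable_pow_div_factorial |t|)
    fun n => ?_)
  rw [norm_mul, norm_div, norm_pow, Real.norm_eq_abs, Real.norm_eq_abs, Real.norm_eq_abs,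
    Nat.abs_cast]
  exact mul_le_of_le_one_right (by positivity) (hb n)

lemma expGen_nonneg {b : ℕ → ℝ} (hb : ∀ n, 0 ≤ b n) {t : ℝ} (ht : 0 ≤ t) : 0 ≤ expGen b t :=
  tsum_nonneg fun n => mul_nonneg (by positivity) (hb n)

lemma expGen_le_exp {b : ℕ → ℝ} (hb : ∀ n, |b n| ≤ 1) {t : ℝ} (ht : 0 ≤ t) :
    expGen b t ≤ Real.exp t := by
  have h : HasSum (fun n : ℕ => t ^ n / (n.factorial : ℝ)) (Real.exp t) := by
    rw [Real.exp_eq_exp_ℝ]; exact NormedSpace.expSeries_div_hasSum_exp t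
  exact hasSum_le (fun n => mul_le_of_le_one_right (by positivity) (le_of_abs_le (hb n)))
    (hasSum_expGen hb t) h

lemma expGen_zero (b : ℕ → ℝ) : expGen b 0 = b 0 := by
  rw [expGen, tsum_eq_single 0 fun n hn => by simp [hn]]
  simp

lemma hasDerivAt_expGen {b : ℕ → ℝ} (hb : ∀ n, |b n| ≤ 1) (t : ℝ) :
    HasDerivAt (expGen b) (expGen (fun n => b (n + 1)) t) t := by
  set R := |t| + 1 with hR
  have hR0 : 0 < R := by positivity
  have hshift (y : ℝ) (n : ℕ) : ((n + 1 : ℕ) : ℝ) * y ^ (n + 1 - 1) / ((n + 1).factorial : ℝ) =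
      y ^ n / (n.factorial : ℝ) := by
    rw [Nat.factorial_succ]; push_cast; field_simp
  have hu : Summable fun n : ℕ => (n : ℝ) * R ^ (n - 1) / (n.factorial : ℝ) := by
    rw [← summable_nat_add_iff 1]
    exact (Real.summable_pow_div_factorial R).congr fun n => (hshift R n).symm
  have hbound : ∀ (n : ℕ) (y : ℝ), y ∈ Metric.ball (0 : ℝ) R →
      ‖(n : ℝ) * y ^ (n - 1) / (n.factorial : ℝ) * b n‖ ≤
        (n : ℝ) * R ^ (n - 1) / (n.factorial : ℝ) := by
    intro n y hy
    rw [mem_ball_zero_iff, Real.norm_eq_abs] at hy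
    rw [norm_mul, norm_div, norm_mul, norm_pow, Real.norm_eq_abs, Real.norm_eq_abs,
      Real.norm_eq_abs, Real.norm_eq_abs, Nat.abs_cast, Nat.abs_cast]
    exact (mul_le_of_le_one_right (by positivity) (hb n)).trans (by gcongr)
  have ht : t ∈ Metric.ball (0 : ℝ) R := by
    rw [mem_ball_zero_iff, Real.norm_eq_abs, hR]; linarith
  have h := hasDerivAt_tsum_of_isPreconnected (𝕜 := ℝ) hu Metric.isOpen_ball
    (convex_ball (0 : ℝ) R).isPreconnected
    (g := fun n y => y ^ n / (n.factorial : ℝ) * b n)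
    (fun n y _ => ((hasDerivAt_pow n y).div_const (n.factorial : ℝ)).mul_const (b n))
    hbound (Metric.mem_ball_self hR0) (hasSum_expGen hb 0).summable ht
  refine h.congr_deriv ?_
  have hsum : Summable fun n : ℕ => (n : ℝ) * t ^ (n - 1) / (n.factorial : ℝ) * b n :=
    Summable.of_norm_bounded hu fun n => hbound n t ht
  rw [hsum.tsum_eq_zero_add, expGen]
  simp only [Nat.cast_zero, zero_mul, zero_div, zero_add, hshift]

lemma continuous_expGen {b : ℕ → ℝ} (hb : ∀ n, |b n| ≤ 1) : Continuous (expGen b) :=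
  continuous_iff_continuousAt.mpr fun t => (hasDerivAt_expGen hb t).continuousAt

lemma expGen_eq_integral {b : ℕ → ℝ} (hb : ∀ n, |b n| ≤ 1) (t : ℝ) :
    expGen b t = b 0 + ∫ s in (0 : ℝ)..t, expGen (fun n => b (n + 1)) s := by
  rw [intervalIntegral.integral_eq_sub_of_hasDerivAt (fun s _ => hasDerivAt_expGen hb s)
    ((continuous_expGen fun n => hb (n + 1)).intervalIntegrable _ _), expGen_zero]
  ring

variable {a : ℤ → ℝ}

lemma abs_convPow_le_one (ha : ∀ z, 0 ≤ a z) (hs : HasSum a 1) (x : ℤ) (n : ℕ) :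
    |convPow a n x| ≤ 1 := by
  rw [abs_of_nonneg (convPow_nonneg ha n x)]
  exact convPow_le_one ha hs n x

lemma heatKernel_eq_exp_mul_expGen (x : ℤ) (t : ℝ) :
    heatKernel a x t = Real.exp (-t) * expGen (fun n => convPow a n x) t := by
  rw [heatKernel, expGen, ← tsum_mul_left]
  exact tsum_congr fun n => by ring

lemma hasSum_mul_expGen_convPow (ha : ∀ z, 0 ≤ a z) (hs : HasSum a 1) (x : ℤ) (t : ℝ) :
    HasSum (fun y => a y * expGen (fun n => convPow a n (x - y)) t)
      (expGen (fun n => convPow a (n + 1) x) t) := by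
  have hF : Summable fun q : ℤ × ℕ =>
      a q.1 * (t ^ q.2 / (q.2.factorial : ℝ) * convPow a q.2 (x - q.1)) := by
    refine Summable.of_norm_bounded (g := fun q : ℤ × ℕ =>
      a q.1 * (|t| ^ q.2 / (q.2.factorial : ℝ)))
      (hs.summable.mul_of_nonneg (Real.summable_pow_div_factorial |t|) ha
        fun n => by positivity) fun q => ?_
    rw [norm_mul, norm_mul, norm_div, norm_pow, Real.norm_eq_abs, Real.norm_eq_abs,
      Real.norm_eq_abs, Real.norm_eq_abs, Nat.abs_cast, abs_of_nonneg (ha _)]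
    exact mul_le_mul_of_nonneg_left (mul_le_of_le_one_right (by positivity)
      (abs_convPow_le_one ha hs _ _)) (ha _)
  have h1 := hF.hasSum.prod_fiberwise fun y =>
    (hasSum_expGen (abs_convPow_le_one ha hs (x - y)) t).mul_left (a y)
  have h2 : HasSum (fun n : ℕ => t ^ n / (n.factorial : ℝ) * convPow a (n + 1) x)
      (∑' q : ℤ × ℕ, a q.1 * (t ^ q.2 / (q.2.factorial : ℝ) * convPow a q.2 (x - q.1))) := by
    refine ((Equiv.prodComm ℕ ℤ).hasSum_iff.mpr hF.hasSum).prod_fiberwise fun n => ?_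
    refine ((summable_mul_convPow ha hs n x).hasSum.mul_left
      (t ^ n / (n.factorial : ℝ))).congr_fun fun y => ?_
    simp only [Function.comp, Equiv.prodComm_apply, Prod.swap]
    ring
  rwa [h2.unique (hasSum_expGen (fun n => abs_convPow_le_one ha hs x (n + 1)) t)] at h1

lemma continuous_heatKernel (ha : ∀ z, 0 ≤ a z) (hs : HasSum a 1) (x : ℤ) :
    Continuous (heatKernel a x) := by
  have h := continuous_expGen (abs_convPow_le_one ha hs x)
  rw [show heatKernel a x = fun t => Real.exp (-t) * expGen (fun n => convPow a n x) t from
    funext fun t => heatKernel_eq_exp_mul_expGen x t]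
  fun_prop

lemma heatKernel_nonneg (ha : ∀ z, 0 ≤ a z) (x : ℤ) {t : ℝ} (ht : 0 ≤ t) :
    0 ≤ heatKernel a x t := by
  rw [heatKernel_eq_exp_mul_expGen]
  exact mul_nonneg (Real.exp_pos _).le (expGen_nonneg (fun n => convPow_nonneg ha n x) ht)

lemma heatKernel_le_one (ha : ∀ z, 0 ≤ a z) (hs : HasSum a 1) (x : ℤ) {t : ℝ} (ht : 0 ≤ t) :
    heatKernel a x t ≤ 1 := by
  rw [heatKernel_eq_exp_mul_expGen, Real.exp_neg, inv_mul_le_one₀ (Real.exp_pos _)]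
  exact expGen_le_exp (abs_convPow_le_one ha hs x) ht

end HeatKernelEquation

section Comparison

open Filter Topology MeasureTheory Set

/-- The weighted Duhamel integral `∫₀ᵗ P_x(t-s) v(s) ds`, where `P_x = e^t p_x`. -/
noncomputable def latticeDuhamel (a : ℤ → ℝ) (v : ℝ → ℝ) (x : ℤ) (t : ℝ) : ℝ :=
  ∫ s in (0 : ℝ)..t, expGen (fun n => convPow a n x) (t - s) * v s

/-- The derivative of `latticeDuhamel` away from the source. -/
noncomputable def latticeDuhamelFlow (a : ℤ → ℝ) (v : ℝ → ℝ) (x : ℤ) (t : ℝ) : ℝ :=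
  ∫ s in (0 : ℝ)..t, expGen (fun n => convPow a (n + 1) x) (t - s) * v s

variable {a : ℤ → ℝ} {v : ℝ → ℝ}

lemma hasSum_latticeDuhamel (ha : ∀ z, 0 ≤ a z) (hs : HasSum a 1) (hv : Continuous v)
    (x : ℤ) {t : ℝ} (ht : 0 ≤ t) :
    HasSum (fun y => a y * latticeDuhamel a v (x - y) t) (latticeDuhamelFlow a v x t) := by
  have hcont (y : ℤ) := continuous_expGen (abs_convPow_le_one ha hs (x - y))
  have h := intervalIntegral.hasSum_integral_of_dominated_convergence (a := 0) (b := t)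
    (μ := volume)
    (F := fun (y : ℤ) s => a y * (expGen (fun n => convPow a n (x - y)) (t - s) * v s))
    (f := fun s => expGen (fun n => convPow a (n + 1) x) (t - s) * v s)
    (fun y s => a y * (Real.exp (t - s) * |v s|))
    (fun y => by
      have := hcont y
      exact (by fun_prop : Continuous fun s => a y *
        (expGen (fun n => convPow a n (x - y)) (t - s) * v s)).aestronglyMeasurable)
    (fun y => ae_of_all _ fun s hs' => by
      rw [uIoc_of_le ht] at hs'
      have hts : 0 ≤ t - s := by linarith [hs'.2]
      rw [norm_mul, norm_mul, Real.norm_eq_abs, Real.norm_eq_abs, Real.norm_eq_abs,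
        abs_of_nonneg (ha y),
        abs_of_nonneg (expGen_nonneg (fun n => convPow_nonneg ha n (x - y)) hts)]
      have := expGen_le_exp (abs_convPow_le_one ha hs (x - y)) hts
      have := ha y
      gcongr)
    (ae_of_all _ fun s _ => hs.summable.mul_right _)
    (by
      simp only [tsum_mul_right]
      exact (by fun_prop : Continuous fun s => (∑' y, a y) *
        (Real.exp (t - s) * |v s|)).intervalIntegrable _ _)
    (ae_of_all _ fun s _ => by
      refine ((hasSum_mul_expGen_convPow ha hs x (t - s)).mul_right (v s)).congr_fun fun y => ?_
      ring)
  refine h.congr_fun fun y => ?_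
  rw [intervalIntegral.integral_const_mul, latticeDuhamel]

lemma continuous_latticeDuhamelFlow (ha : ∀ z, 0 ≤ a z) (hs : HasSum a 1) (hv : Continuous v)
    (x : ℤ) : Continuous (latticeDuhamelFlow a v x) := by
  have h := continuous_expGen fun n => abs_convPow_le_one ha hs x (n + 1)
  exact intervalIntegral.continuous_parametric_intervalIntegral_of_continuous
    (f := fun t s => expGen (fun n => convPow a (n + 1) x) (t - s) * v s)
    (by unfold Function.uncurry; fun_prop) continuous_id

lemma latticeDuhamel_eq (ha : ∀ z, 0 ≤ a z) (hs : HasSum a 1) (hv : Continuous v)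
    (hv0 : ∀ s, 0 ≤ v s) (x : ℤ) {t : ℝ} (ht : 0 ≤ t) :
    latticeDuhamel a v x t = ∫ s in (0 : ℝ)..t,
      (convPow a 0 x * v s + latticeDuhamelFlow a v x s) := by
  have hQ := continuous_expGen fun n => abs_convPow_le_one ha hs x (n + 1)
  have hQ0 : ∀ s > 0, 0 ≤ expGen (fun n => convPow a (n + 1) x) s := fun s h =>
    expGen_nonneg (fun n => convPow_nonneg ha (n + 1) x) (le_of_lt h)
  have hassoc := volterra_assoc (k := fun _ => 1) (u := v) (fun _ _ => zero_le_one) hQ0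
    (fun s _ => hv0 s) aemeasurable_const hQ.measurable.aemeasurable hv.measurable.aemeasurable
    (fun r _ => (by fun_prop : Continuous fun s =>
      1 * expGen (fun n => convPow a (n + 1) x) s).intervalIntegrable _ _)
    (fun r _ => (by fun_prop : Continuous fun s =>
      expGen (fun n => convPow a (n + 1) x) (r - s) * v s).intervalIntegrable _ _) ht
  simp only [one_mul] at hassoc
  have hprim : Continuous fun t => ∫ r in (0 : ℝ)..t, expGen (fun n => convPow a (n + 1) x) r :=
    intervalIntegral.continuous_primitive (fun _ _ => hQ.intervalIntegrable _ _) 0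
  rw [intervalIntegral.integral_add ((hv.const_mul _).intervalIntegrable _ _)
    ((continuous_latticeDuhamelFlow ha hs hv x).intervalIntegrable _ _)]
  simp only [latticeDuhamelFlow]
  rw [hassoc, latticeDuhamel, ← intervalIntegral.integral_add
    ((hv.const_mul _).intervalIntegrable _ _)
    ((by fun_prop : Continuous fun s => (∫ r in (0 : ℝ)..(t - s),
      expGen (fun n => convPow a (n + 1) x) r) * v s).intervalIntegrable _ _)]
  refine intervalIntegral.integral_congr fun s _ => ?_
  rw [expGen_eq_integral (abs_convPow_le_one ha hs x) (t - s)]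
  ring

lemma hasDerivWithinAt_latticeDuhamel (ha : ∀ z, 0 ≤ a z) (hs : HasSum a 1) (hv : Continuous v)
    (hv0 : ∀ s, 0 ≤ v s) (x : ℤ) {t : ℝ} (ht : 0 ≤ t) :
    HasDerivWithinAt (latticeDuhamel a v x)
      (convPow a 0 x * v t + latticeDuhamelFlow a v x t) (Ici 0) t := by
  have hc : Continuous fun s => convPow a 0 x * v s + latticeDuhamelFlow a v x s :=
    (hv.const_mul _).add (continuous_latticeDuhamelFlow ha hs hv x)
  refine (hc.integral_hasStrictDerivAt 0 t).hasDerivAt.hasDerivWithinAt.congr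
    (fun s h => latticeDuhamel_eq ha hs hv hv0 x h) (latticeDuhamel_eq ha hs hv hv0 x ht)

lemma latticeDuhamel_nonneg (ha : ∀ z, 0 ≤ a z) (hv0 : ∀ s, 0 ≤ v s) (x : ℤ) {t : ℝ}
    (ht : 0 ≤ t) : 0 ≤ latticeDuhamel a v x t :=
  intervalIntegral.integral_nonneg ht fun s h =>
    mul_nonneg (expGen_nonneg (fun n => convPow_nonneg ha n x) (by linarith [h.2])) (hv0 s)

lemma latticeDuhamel_le (ha : ∀ z, 0 ≤ a z) (hs : HasSum a 1) (hv : Continuous v)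
    (hv0 : ∀ s, 0 ≤ v s) {γ : ℝ} (hvγ : ∀ s ≥ 0, v s ≤ γ * Real.exp s) (x : ℤ) {t : ℝ}
    (ht : 0 ≤ t) : latticeDuhamel a v x t ≤ γ * t * Real.exp t := by
  have hP := continuous_expGen (abs_convPow_le_one ha hs x)
  have h : latticeDuhamel a v x t ≤ ∫ s in (0 : ℝ)..t, γ * Real.exp t := by
    refine intervalIntegral.integral_mono_on ht ((by fun_prop : Continuous fun s =>
      expGen (fun n => convPow a n x) (t - s) * v s).intervalIntegrable _ _) (by simp)
      fun s h => ?_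
    calc expGen (fun n => convPow a n x) (t - s) * v s
        ≤ Real.exp (t - s) * (γ * Real.exp s) :=
          mul_le_mul (expGen_le_exp (abs_convPow_le_one ha hs x) (by linarith [h.2]))
            (hvγ s h.1) (hv0 s) (Real.exp_pos _).le
      _ = γ * Real.exp t := by
          rw [show Real.exp t = Real.exp (t - s) * Real.exp s by rw [← Real.exp_add]; ring_nf]
          ring
  rw [intervalIntegral.integral_const, smul_eq_mul, sub_zero] at h
  linarith

/-- Minimum principle for a family of functions indexed by the lattice: the derivative needs to
dominate the averaging operator only where the function is nonpositive. -/
lemma lattice_minimum_principle (ha : ∀ z, 0 ≤ a z) (hs : HasSum a 1) {W D S : ℤ → ℝ → ℝ}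
    {M T : ℝ} (hW0 : ∀ x, 0 ≤ W x 0)
    (hder : ∀ x, ∀ t ∈ Icc 0 T, HasDerivWithinAt (W x) (D x t) (Ici 0) t)
    (hS : ∀ x, ∀ t ∈ Icc 0 T, HasSum (fun y => a y * W (x - y) t) (S x t))
    (hD : ∀ x, ∀ t ∈ Icc 0 T, W x t ≤ 0 → S x t ≤ D x t)
    (hM : ∀ x, ∀ t ∈ Icc 0 T, -(M * Real.exp t) ≤ W x t) (x : ℤ) {t : ℝ} (ht : t ∈ Icc 0 T) :
    0 ≤ W x t := by
  have step : ∀ K ≥ 0, (∀ x, ∀ t ∈ Icc 0 T, -(K * Real.exp t) ≤ W x t) →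
      ∀ x, ∀ t ∈ Icc 0 T, -(K * (Real.exp t - 1)) ≤ W x t := by
    intro K hK hKW x t ht
    have hlt : ∀ K' > K, -W x t ≤ K' * (Real.exp t - 1) := by
      intro K' hK'
      refine image_le_of_deriv_right_lt_deriv_boundary' (a := 0) (b := T)
        (f := fun t => -W x t) (f' := fun t => -D x t) (B := fun t => K' * (Real.exp t - 1))
        (B' := fun t => K' * Real.exp t)
        (fun s hs' => ((hder x s hs').continuousWithinAt.mono Icc_subset_Ici_self).neg)
        (fun s hs' => ((hder x s (Ico_subset_Icc_self hs')).mono (Ici_subset_Ici.mpr hs'.1)).neg)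
        (by simpa using hW0 x) (by fun_prop)
        (fun s _ => (((Real.hasDerivAt_exp s).sub_const 1).const_mul K').hasDerivWithinAt)
        (fun s hs' heq => ?_) ht
      have hs'' := Ico_subset_Icc_self hs'
      have hW : W x s ≤ 0 := by
        have h1 := Real.one_le_exp hs'.1
        have : 0 ≤ K' * (Real.exp s - 1) := mul_nonneg (by linarith) (by linarith)
        linarith
      have h1 : -(K * Real.exp s) ≤ S x s := by
        have h2 := hs.mul_right (-(K * Real.exp s))
        rw [one_mul] at h2
        exact hasSum_le (fun y => mul_le_mul_of_nonneg_left (hKW _ s hs'') (ha y)) h2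
          (hS x s hs'')
      have h3 := hD x s hs'' hW
      have h4 := mul_lt_mul_of_pos_right hK' (Real.exp_pos s)
      linarith
    have h1 : Tendsto (fun K' => K' * (Real.exp t - 1)) (𝓝[>] K) (𝓝 (K * (Real.exp t - 1))) :=
      ((continuous_id.mul continuous_const).tendsto K).mono_left nhdsWithin_le_nhds
    have h2 := ge_of_tendsto h1 (eventually_mem_nhdsWithin.mono fun K' hK' => hlt K' hK')
    linarith
  have hT : 0 ≤ T := ht.1.trans ht.2
  set q := 1 - Real.exp (-T) with hq
  have hq0 : 0 ≤ q := by
    have : Real.exp (-T) ≤ 1 := Real.exp_le_one_iff.mpr (by linarith)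
    linarith
  have hq1 : q < 1 := by have := Real.exp_pos (-T); linarith
  have iter : ∀ n : ℕ, ∀ x, ∀ t ∈ Icc 0 T, -(max M 0 * q ^ n * Real.exp t) ≤ W x t := by
    intro n
    induction n with
    | zero =>
      intro x t ht
      refine le_trans ?_ (hM x t ht)
      rw [pow_zero, mul_one]
      have := mul_le_mul_of_nonneg_right (le_max_left M 0) (Real.exp_pos t).le
      linarith
    | succ n ih =>
      intro x t ht
      have hK : 0 ≤ max M 0 * q ^ n := by positivity
      refine le_trans ?_ (step _ hK ih x t ht)
      have h1 : Real.exp t - 1 ≤ q * Real.exp t := by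
        have h2 : 1 ≤ Real.exp (-T) * Real.exp T := by rw [← Real.exp_add]; simp
        have h3 : Real.exp (-T) * Real.exp t ≤ 1 := by
          rw [← Real.exp_add]; exact Real.exp_le_one_iff.mpr (by linarith [ht.2])
        rw [hq]; linarith
      have h4 := mul_le_mul_of_nonneg_left h1 hK
      rw [pow_succ]
      linarith
  have hlim : Tendsto (fun n : ℕ => -(max M 0 * q ^ n * Real.exp t)) atTop (𝓝 0) := by
    simpa using (((tendsto_pow_atTop_nhds_zero_of_lt_one hq0 hq1).const_mul
      (max M 0)).mul_const (Real.exp t)).neg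
  exact le_of_tendsto' hlim fun n => iter n x t ht

end Comparison

section Monotonicity

open Filter Topology MeasureTheory Set

variable {a : ℤ → ℝ} {f : ℝ → ℝ} {γ α : ℝ}

lemma latticeDuhamel_source (hf_eq : ∀ t ≥ (0 : ℝ),
      f t = ∫ s in (0 : ℝ)..t, heatKernel a 0 (t - s) * expSource γ α f s) {t : ℝ}
    (ht : 0 ≤ t) :
    latticeDuhamel a (fun s => Real.exp s * expSource γ α f s) 0 t = Real.exp t * f t := by
  rw [hf_eq t ht, ← intervalIntegral.integral_const_mul, latticeDuhamel]
  refine intervalIntegral.integral_congr fun s _ => ?_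
  simp only [heatKernel_eq_exp_mul_expGen]
  rw [show Real.exp s = Real.exp t * Real.exp (-(t - s)) by rw [← Real.exp_add]; ring_nf]
  ring

/-- Solutions of the semilinear lattice Duhamel equation are nondecreasing. -/
lemma monotoneOn_of_duhamel (ha : ∀ z, 0 ≤ a z) (hs : HasSum a 1) (hγ : 0 < γ) (hα : 0 < α)
    (hf : Continuous f) (hf0 : ∀ t ≥ 0, 0 ≤ f t) (hf_eq : ∀ t ≥ (0 : ℝ),
      f t = ∫ s in (0 : ℝ)..t, heatKernel a 0 (t - s) * expSource γ α f s) :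
    MonotoneOn f (Ici 0) := by
  intro t (ht : 0 ≤ t) t' _ htt'
  obtain ⟨h, hh, rfl⟩ : ∃ h ≥ 0, t' = t + h := ⟨t' - t, by linarith, by ring⟩
  set v : ℝ → ℝ := fun s => Real.exp s * expSource γ α f s with hv_def
  have hv : Continuous v := by rw [hv_def]; unfold expSource; fun_prop
  have hv0 : ∀ s, 0 ≤ v s := fun s =>
    mul_nonneg (Real.exp_pos _).le (mul_nonneg hγ.le (Real.exp_pos _).le)
  have hvγ : ∀ s ≥ 0, v s ≤ γ * Real.exp s := by
    intro s hs'
    rw [mul_comm γ]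
    refine mul_le_mul_of_nonneg_left (mul_le_of_le_one_right hγ.le ?_) (Real.exp_pos _).le
    exact Real.exp_le_one_iff.mpr (neg_nonpos.mpr (mul_nonneg hα.le (hf0 s hs')))
  have hF0 {s : ℝ} (hs' : 0 ≤ s) : latticeDuhamel a v 0 s = Real.exp s * f s :=
    latticeDuhamel_source hf_eq hs'
  have hW0 {s : ℝ} (hs' : 0 ≤ s) :
      Real.exp (-h) * latticeDuhamel a v 0 (s + h) - latticeDuhamel a v 0 s =
        Real.exp s * (f (s + h) - f s) := by
    rw [hF0 hs', hF0 (add_nonneg hs' hh), Real.exp_add, Real.exp_neg]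
    field_simp
  have key := lattice_minimum_principle ha hs (T := t) (M := γ * t)
    (W := fun x s => Real.exp (-h) * latticeDuhamel a v x (s + h) - latticeDuhamel a v x s)
    (D := fun x s => Real.exp (-h) * (convPow a 0 x * v (s + h) + latticeDuhamelFlow a v x (s + h))
      - (convPow a 0 x * v s + latticeDuhamelFlow a v x s))
    (S := fun x s => Real.exp (-h) * latticeDuhamelFlow a v x (s + h) -
      latticeDuhamelFlow a v x s)
    (fun x => by
      have h1 := latticeDuhamel_nonneg ha hv0 x (t := 0 + h) (by linarith)
      have h2 : latticeDuhamel a v x 0 = 0 := by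
        rw [latticeDuhamel, intervalIntegral.integral_same]
      simp only [h2, sub_zero]
      positivity)
    (fun x s hs' => by
      have h1 := hasDerivWithinAt_latticeDuhamel ha hs hv hv0 x (add_nonneg hs'.1 hh)
      have h2 : HasDerivWithinAt (fun s => s + h) 1 (Ici 0) s :=
        ((hasDerivAt_id s).add_const h).hasDerivWithinAt
      have h3 := h1.comp s h2 fun r hr => add_nonneg hr hh
      rw [mul_one] at h3
      exact (h3.const_mul _).sub (hasDerivWithinAt_latticeDuhamel ha hs hv hv0 x hs'.1))
    (fun x s hs' => by
      refine (((hasSum_latticeDuhamel ha hs hv x (add_nonneg hs'.1 hh)).mul_left _).sub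
        (hasSum_latticeDuhamel ha hs hv x hs'.1)).congr_fun fun y => ?_
      ring)
    (fun x s hs' hW => by
      by_cases hx : x = 0
      · subst hx
        rw [hW0 hs'.1] at hW
        have h1 : f (s + h) ≤ f s := by
          by_contra! hlt
          exact absurd hW (not_le.mpr (mul_pos (Real.exp_pos _) (sub_pos.mpr hlt)))
        have h2 : v s ≤ Real.exp (-h) * v (s + h) := by
          have h3 : Real.exp (-h) * v (s + h) = Real.exp s * expSource γ α f (s + h) := by
            simp only [hv_def]
            rw [Real.exp_add, Real.exp_neg]
            field_simp
          rw [h3]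
          simp only [hv_def, expSource]
          gcongr
        simp only [convPow, if_true]
        linarith
      · simp only [convPow, if_neg hx]
        linarith)
    (fun x s hs' => by
      have h1 := mul_nonneg (Real.exp_pos (-h)).le
        (latticeDuhamel_nonneg ha hv0 x (t := s + h) (by linarith [hs'.1]))
      have h2 := latticeDuhamel_le ha hs hv hv0 hvγ x hs'.1
      have h3 : γ * s * Real.exp s ≤ γ * t * Real.exp s := by
        have := hs'.2
        gcongr
      linarith)
    0 (t := t) ⟨ht, le_rfl⟩
  rw [hW0 ht] at key
  linarith [nonneg_of_mul_nonneg_right key (Real.exp_pos t)]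

end Monotonicity

/-- Long-time asymptotics of the solution of the Duhamel equation
`f(t) = γ ∫₀ᵗ p₀(t−s) e^{−α f(s)} ds`: `f` is nondecreasing,
`f(t) = (1/α)[(1/2)log t − log log t + log(√(2π)γα/σ)] + o(1)`, and the total mass
`γ ∫₀ᵗ e^{−α f(s)} ds ∼ (σ/α)√(2/π)·√t·log t`. -/
theorem semilinear_heat_eq_asymptotics
    (a : ℤ → ℝ) (ha_nonneg : ∀ z, 0 ≤ a z) (ha_sum : HasSum a 1)
    (ha_mean : HasSum (fun z : ℤ => (z : ℝ) * a z) 0)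
    (σ : ℝ) (hσ : 0 < σ) (ha_var : HasSum (fun z : ℤ => (z : ℝ) ^ 2 * a z) (σ ^ 2))
    (ha_gen : AddSubgroup.closure (Function.support a) = (⊤ : AddSubgroup ℤ))
    (γ α : ℝ) (hγ : 0 < γ) (hα : 0 < α)
    (f : ℝ → ℝ) (hf_cont : ContinuousOn f (Set.Ici 0))
    (hf_nonneg : ∀ t ≥ (0 : ℝ), 0 ≤ f t)
    (hf_eq : ∀ t ≥ (0 : ℝ),
      f t = γ * ∫ s in (0 : ℝ)..t, heatKernel a 0 (t - s) * Real.exp (-(α * f s))) :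
    MonotoneOn f (Set.Ici 0) ∧
    Filter.Tendsto (fun t => f t - (1 / α) *
        ((1 / 2) * Real.log t - Real.log (Real.log t)
          + Real.log (Real.sqrt (2 * π) * γ * α / σ)))
      Filter.atTop (nhds 0) ∧
    Filter.Tendsto (fun t =>
        (γ * ∫ s in (0 : ℝ)..t, Real.exp (-(α * f s)))
          / ((σ / α) * Real.sqrt (2 / π) * Real.sqrt t * Real.log t))
      Filter.atTop (nhds 1) := by
  have hp : SqrtDecay (heatKernel a 0) (1 / (σ * √(2 * π))) :=
    { cont := continuous_heatKernel ha_nonneg ha_sum 0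
      nonneg := fun t ht => heatKernel_nonneg ha_nonneg 0 ht
      le_one := fun t ht => heatKernel_le_one ha_nonneg ha_sum 0 ht
      pos := by positivity
      tendsto := tendsto_sqrt_mul_heatKernel ha_nonneg ha_sum ha_mean hσ ha_var ha_gen }
  set g : ℝ → ℝ := fun t => f (max t 0) with hg_def
  have hgf : ∀ t ≥ 0, g t = f t := fun t ht => by rw [hg_def]; simp only [max_eq_left ht]
  have hg_cont : Continuous g :=
    hf_cont.comp_continuous (by fun_prop) fun t => Set.mem_Ici.mpr (le_max_right t 0)
  have hg_nonneg : ∀ t ≥ 0, 0 ≤ g t := fun t _ => hf_nonneg _ (le_max_right t 0)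
  have hg_eq : ∀ t ≥ (0 : ℝ),
      g t = ∫ s in (0 : ℝ)..t, heatKernel a 0 (t - s) * expSource γ α g s := by
    intro t ht
    rw [hgf t ht, hf_eq t ht, ← intervalIntegral.integral_const_mul]
    refine intervalIntegral.integral_congr fun s hs => ?_
    rw [Set.uIcc_of_le ht] at hs
    simp only [expSource, hgf s hs.1]
    ring
  have hg_mono := monotoneOn_of_duhamel ha_nonneg ha_sum hγ hα hg_cont hg_nonneg hg_eq
  have hsol : MonotoneVolterraSolution (heatKernel a 0) g γ α :=
    ⟨hγ, hα, hg_cont, hg_nonneg, hg_mono, hg_eq⟩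
  have h2π : √(2 * π) * √(2 * π) = 2 * π := Real.mul_self_sqrt (by positivity)
  refine ⟨hg_mono.congr fun t ht => hgf t ht, ?_, ?_⟩
  · have hconst : 2 * α * (1 / (σ * √(2 * π))) * π * γ = √(2 * π) * γ * α / σ := by
      have : 0 < √(2 * π) := by positivity
      rw [div_eq_mul_inv (√(2 * π) * γ * α)]
      field_simp
      linear_combination (-1 : ℝ) * h2π
    have h := hsol.tendsto_sub_log hp
    rw [hconst] at h
    refine h.congr' ?_
    filter_upwards [Filter.eventually_ge_atTop 0] with t ht
    rw [hgf t ht]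
  · have h := (hsol.tendsto_integral_source hp).div_const (1 / (α * (1 / (σ * √(2 * π))) * π))
    have hpos : 0 < 1 / (α * (1 / (σ * √(2 * π))) * π) := by positivity
    rw [div_self hpos.ne'] at h
    refine h.congr' ?_
    filter_upwards [Filter.eventually_gt_atTop 0] with t ht
    have hint : ∫ s in (0 : ℝ)..t, expSource γ α g s =
        γ * ∫ s in (0 : ℝ)..t, Real.exp (-(α * f s)) := by
      rw [← intervalIntegral.integral_const_mul]
      refine intervalIntegral.integral_congr fun s hs => ?_
      rw [Set.uIcc_of_le ht.le] at hs
      simp only [expSource, hgf s hs.1]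
    have hconst : 1 / (α * (1 / (σ * √(2 * π))) * π) = σ / α * √(2 / π) := by
      have h2 : √(2 * π) = √(2 / π) * π := by
        rw [← Real.sqrt_sq pi_pos.le, ← Real.sqrt_mul (by positivity), Real.sqrt_sq pi_pos.le]
        congr 1
        field_simp
      have h3 : 0 < √(2 / π) := by positivity
      rw [h2]
      field_simp
    rw [hint, hconst, div_div]
    congr 1
    ring
end

section
/- For every x ∈ ℝ, (1/(2π)) ∫₀¹ (s(1−s))^{−1/2} · exp(−x²/(2s)) ds = (1/√(2π)) ∫_{|x|}^{∞} exp(−z²/2) dz. -/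
open Real

open MeasureTheory Set Filter Topology

lemma hasDerivAt_neg_exp_div {b : ℝ} (hb : 0 < b) (z : ℝ) :
    HasDerivAt (fun z : ℝ => -(exp (-(z ^ 2 * b) / 2) / b)) (z * exp (-(z ^ 2 * b) / 2)) z := by
  have h := (((((hasDerivAt_pow 2 z).mul_const b).neg.div_const 2).exp).div_const b).neg
  refine h.congr_deriv ?_
  simp only [Pi.neg_apply]
  field_simp
  simp [mul_comm]

lemma tendsto_neg_exp_div {b : ℝ} (hb : 0 < b) :
    Tendsto (fun z : ℝ => -(exp (-(z ^ 2 * b) / 2) / b)) atTop (𝓝 0) := by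
  have h1 : Tendsto (fun z : ℝ => z ^ 2 * (b / 2)) atTop atTop :=
    (tendsto_pow_atTop two_ne_zero).atTop_mul_const (by positivity)
  have h2 := ((tendsto_exp_neg_atTop_nhds_zero.comp h1).div_const b).neg
  simp only [zero_div, neg_zero] at h2
  refine h2.congr fun z => ?_
  simp only [Function.comp]
  ring_nf

lemma integrableOn_mul_exp {a b : ℝ} (ha : 0 ≤ a) (hb : 0 < b) :
    IntegrableOn (fun z : ℝ => z * exp (-(z ^ 2 * b) / 2)) (Ioi a) :=
  integrableOn_Ioi_deriv_of_nonneg' (fun z _ => hasDerivAt_neg_exp_div hb z)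
    (fun _ hz => mul_nonneg (ha.trans (le_of_lt hz)) (exp_pos _).le) (tendsto_neg_exp_div hb)

lemma integral_mul_exp {a b : ℝ} (ha : 0 ≤ a) (hb : 0 < b) :
    ∫ z in Ioi a, z * exp (-(z ^ 2 * b) / 2) = exp (-(a ^ 2 * b) / 2) / b := by
  rw [integral_Ioi_of_hasDerivAt_of_nonneg' (fun z _ => hasDerivAt_neg_exp_div hb z)
    (fun _ hz => mul_nonneg (ha.trans (le_of_lt hz)) (exp_pos _).le) (tendsto_neg_exp_div hb)]
  ring

lemma integrable_prod_mul_exp {a : ℝ} (ha : 0 ≤ a) :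
    Integrable (Function.uncurry fun t z : ℝ => z * exp (-(z ^ 2 * (1 + t ^ 2)) / 2))
      ((volume.restrict (Ioi 0)).prod (volume.restrict (Ioi a))) := by
  rw [integrable_prod_iff (Continuous.aestronglyMeasurable (by fun_prop))]
  refine ⟨Eventually.of_forall fun t => integrableOn_mul_exp ha (b := 1 + t ^ 2) (by positivity), ?_⟩
  have h (t : ℝ) : ∫ z in Ioi a, ‖z * exp (-(z ^ 2 * (1 + t ^ 2)) / 2)‖
      = exp (-(a ^ 2 * (1 + t ^ 2)) / 2) / (1 + t ^ 2) := by
    rw [← integral_mul_exp ha (by positivity)]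
    refine setIntegral_congr_fun measurableSet_Ioi fun z hz => ?_
    exact norm_of_nonneg (mul_nonneg (ha.trans (le_of_lt hz)) (exp_pos _).le)
  simp only [Function.uncurry_apply_pair, h]
  refine (integrable_inv_one_add_sq.restrict (s := Ioi 0)).mono'
    (Continuous.aestronglyMeasurable ?_) (Eventually.of_forall fun t => ?_)
  · exact Continuous.div (by fun_prop) (by fun_prop) fun t => by positivity
  · rw [norm_of_nonneg (by positivity), div_eq_mul_inv]
    refine mul_le_of_le_one_left (by positivity) (exp_le_one_iff.2 ?_)
    have : 0 ≤ a ^ 2 * (1 + t ^ 2) := by positivity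
    linarith

lemma integral_exp_div_one_add_sq {a : ℝ} (ha : 0 ≤ a) :
    ∫ t in Ioi (0 : ℝ), exp (-(a ^ 2 * (1 + t ^ 2)) / 2) / (1 + t ^ 2)
      = √(2 * π) / 2 * ∫ z in Ioi a, exp (-(z ^ 2) / 2) := by
  have h (t : ℝ) := integral_mul_exp ha (b := 1 + t ^ 2) (by positivity)
  simp only [← h]
  rw [integral_integral_swap (integrable_prod_mul_exp ha), ← integral_const_mul]
  refine setIntegral_congr_fun measurableSet_Ioi fun z hz => ?_
  have hz : 0 < z := ha.trans_lt hz
  have h2 (t : ℝ) : z * exp (-(z ^ 2 * (1 + t ^ 2)) / 2)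
      = z * exp (-(z ^ 2) / 2) * exp (-(z ^ 2 / 2) * t ^ 2) := by
    rw [mul_assoc, ← exp_add]
    ring_nf
  simp only [h2]
  rw [integral_const_mul, integral_gaussian_Ioi]
  have h3 : √(π / (z ^ 2 / 2)) = √(2 * π) / z := by
    rw [show π / (z ^ 2 / 2) = 2 * π / z ^ 2 by field_simp, sqrt_div (by positivity),
      sqrt_sq hz.le]
  rw [h3]
  field_simp

lemma image_inv_one_add_sq :
    (fun t : ℝ => (1 + t ^ 2)⁻¹) '' Ioi 0 = Ioo 0 1 := by
  ext s
  constructor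
  · rintro ⟨t, ht, rfl⟩
    have ht : 0 < t := ht
    exact ⟨by positivity, inv_lt_one_of_one_lt₀ (by nlinarith [sq_pos_of_pos ht])⟩
  · rintro ⟨h0, h1⟩
    have h : 0 < s⁻¹ - 1 := sub_pos.2 ((one_lt_inv₀ h0).2 h1)
    refine ⟨√(s⁻¹ - 1), sqrt_pos.2 h, ?_⟩
    simp [sq_sqrt h.le]

lemma injOn_inv_one_add_sq : InjOn (fun t : ℝ => (1 + t ^ 2)⁻¹) (Ioi 0) := by
  intro t ht u hu h
  have h' : t ^ 2 = u ^ 2 := by simpa using h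
  exact (sq_eq_sq₀ (le_of_lt ht) (le_of_lt hu)).1 h'

lemma hasDerivAt_inv_one_add_sq (t : ℝ) :
    HasDerivAt (fun t : ℝ => (1 + t ^ 2)⁻¹) (-(2 * t) / (1 + t ^ 2) ^ 2) t := by
  have h := ((hasDerivAt_pow 2 t).const_add 1).inv (by positivity)
  exact h.congr_deriv (by simp)

lemma integral_arcsine_exp (x : ℝ) :
    ∫ s in (0 : ℝ)..1, (1 / √(s * (1 - s))) * exp (-(x ^ 2) / (2 * s))
      = 2 * ∫ t in Ioi (0 : ℝ), exp (-(x ^ 2 * (1 + t ^ 2)) / 2) / (1 + t ^ 2) := by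
  rw [intervalIntegral.integral_of_le zero_le_one, integral_Ioc_eq_integral_Ioo,
    ← image_inv_one_add_sq, integral_image_eq_integral_abs_deriv_smul measurableSet_Ioi
      (fun t _ => (hasDerivAt_inv_one_add_sq t).hasDerivWithinAt) injOn_inv_one_add_sq,
    ← integral_const_mul]
  refine setIntegral_congr_fun measurableSet_Ioi fun t ht => ?_
  have ht : 0 < t := ht
  have h1 : √((1 + t ^ 2)⁻¹ * (1 - (1 + t ^ 2)⁻¹)) = t / (1 + t ^ 2) := by
    rw [← sqrt_sq (show 0 ≤ t / (1 + t ^ 2) by positivity)]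
    congr 1
    field_simp
    ring
  have h2 : -(x ^ 2) / (2 * (1 + t ^ 2)⁻¹) = -(x ^ 2 * (1 + t ^ 2)) / 2 := by
    field_simp
  have h3 : |-(2 * t) / (1 + t ^ 2) ^ 2| = 2 * t / (1 + t ^ 2) ^ 2 := by
    rw [neg_div, abs_neg, abs_of_pos (by positivity)]
  simp only [h1, h2, h3, smul_eq_mul]
  field_simp

/-- The limiting macroscopic profile identity:
`(1/(2π)) ∫₀¹ (s(1−s))^{−1/2} e^{−x²/(2s)} ds = (1/√(2π)) ∫_{|x|}^∞ e^{−z²/2} dz`. -/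
theorem profile_integral_identity (x : ℝ) :
    (1 / (2 * π)) * ∫ s in (0 : ℝ)..1,
        (1 / Real.sqrt (s * (1 - s))) * Real.exp (-(x ^ 2) / (2 * s))
      = (1 / Real.sqrt (2 * π)) * ∫ z in Set.Ioi |x|, Real.exp (-(z ^ 2) / 2) := by
  rw [integral_arcsine_exp, ← sq_abs x, integral_exp_div_one_add_sq (abs_nonneg x)]
  have h : √(2 * π) ^ 2 = 2 * π := sq_sqrt (by positivity)
  have h0 : 0 < √(2 * π) := by positivity
  rw [← mul_assoc, ← mul_assoc]
  congr 1
  rw [← h, sqrt_sq h0.le]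
  field_simp
end

section
/- Let (Ω, 𝓕, P) be a probability space, (S, 𝓢) a measurable space, ν a measure on S, k ∈ ℕ with k ≥ 2, and E₁, …, E_k ∈ 𝓢 with ν(E_i) < ∞ for each i. Let A₁, …, A_k be events such that for every subset I ⊆ {1,…,k}, P(⋂_{i∈I} A_i) = exp(−ν(⋃_{i∈I} E_i)). Set x := 2^k · max_{1 ≤ i < j ≤ k} ν(E_i ∩ E_j). Then for every M ∈ ℕ ∪ {0}, | E[ ∏_{i=1}^k (𝟙_{A_i} − P(A_i)) ] − exp(−∑_{i=1}^k ν(E_i)) · ∑_{n=1}^{M} (1/n!) ∑_{I₁,…,I_n} (−1)^{∑_j |I_j|} ∏_j ν(⋂_{ℓ∈I_j} E_ℓ) | ≤ exp(−∑_{i=1}^k ν(E_i)) · 2^k · x^{M+1}/(M+1)! · e^{x}, where the inner sum runs over all n-tuples (I₁,…,I_n) of subsets of {1,…,k} with |I_j| ≥ 2 for every j and I₁ ∪ ⋯ ∪ I_n = {1,…,k}. -/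
open MeasureTheory
open scoped BigOperators Classical

/-- The `n`-th term of the correlation series for Poisson vacancy events:
`(1/n!) ∑_{I₁,…,I_n} (−1)^{∑|I_j|} ∏_j ν(⋂_{ℓ∈I_j} E_ℓ)`, where the sum runs over
`n`-tuples of subsets of `{1,…,k}`, each of cardinality `≥ 2`, whose union is
`{1,…,k}`. -/
noncomputable def poisCorrTerm {S : Type*} [MeasurableSpace S] (ν : Measure S)
    {k : ℕ} (E : Fin k → Set S) (n : ℕ) : ℝ :=
  (1 / (n.factorial : ℝ)) *
    ∑ Is ∈ Finset.univ.filter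
        (fun Is : Fin n → Finset (Fin k) =>
          (∀ j, 2 ≤ (Is j).card) ∧ Finset.univ.biUnion Is = Finset.univ),
      (-1 : ℝ) ^ (∑ j, (Is j).card) * ∏ j, (ν (⋂ ℓ ∈ Is j, E ℓ)).toReal

open Finset in
/-- Summing the signs `(-1) ^ #Iᶜ` over all `I ⊇ U` gives `1` if `U` is everything and `0`
otherwise. -/
theorem sum_neg_one_pow_card_compl_of_subset {ι : Type*} [Fintype ι] [DecidableEq ι]
    (U : Finset ι) :
    ∑ I : Finset ι, (if U ⊆ I then (-1 : ℝ) ^ #Iᶜ else 0) = if U = univ then 1 else 0 := by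
  have h := prod_add (fun _ : ι => (1 : ℝ)) (fun i => if i ∈ U then 0 else -1) univ
  rw [powerset_univ] at h
  have hl : ∏ i, ((1 : ℝ) + if i ∈ U then 0 else -1) = if U = univ then 1 else 0 := by
    split_ifs with hU
    · simp [hU]
    · obtain ⟨i, hi⟩ : ∃ i, i ∉ U := by
        by_contra! hall
        exact hU (eq_univ_iff_forall.2 hall)
      exact prod_eq_zero (mem_univ i) (by simp [hi])
  rw [← hl, h]
  refine sum_congr rfl fun I _ => ?_
  rw [prod_const_one, one_mul, ← compl_eq_univ_sdiff]
  split_ifs with hUI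
  · rw [← prod_const]
    refine prod_congr rfl fun i hi => ?_
    rw [if_neg fun hiU => mem_compl.1 hi (hUI hiU)]
  · obtain ⟨i, hiU, hiI⟩ := not_subset.1 hUI
    exact (prod_eq_zero (mem_compl.2 hiI) (by simp [hiU])).symm

/-- Lagrange-type bound for the tail of the exponential series at a nonnegative real. -/
theorem exp_sub_sum_range_le_of_nonneg {t : ℝ} (ht : 0 ≤ t) (n : ℕ) :
    Real.exp t - ∑ m ∈ Finset.range n, t ^ m / m.factorial
      ≤ t ^ n / n.factorial * Real.exp t := by
  have hs := Real.summable_pow_div_factorial t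
  have he : Real.exp t = ∑' i : ℕ, t ^ i / i.factorial := by
    rw [Real.exp_eq_exp_ℝ, NormedSpace.exp_eq_tsum_div]
  rw [sub_le_iff_le_add', he, ← tsum_mul_left]
  refine (hs.sum_add_tsum_nat_add n).ge.trans ?_
  refine add_le_add le_rfl ?_
  refine ((summable_nat_add_iff n).2 hs).tsum_le_tsum (fun i => ?_) (hs.mul_left _)
  rw [div_mul_div_comm, ← pow_add, add_comm i n]
  gcongr
  exact_mod_cast Nat.le_of_dvd (Nat.factorial_pos _)
    (Nat.factorial_mul_factorial_dvd_factorial_add n i)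

/-- Taylor remainder bound for the real exponential. -/
theorem abs_exp_sub_sum_range_le (t : ℝ) (n : ℕ) :
    |Real.exp t - ∑ m ∈ Finset.range n, t ^ m / m.factorial|
      ≤ |t| ^ n / n.factorial * Real.exp |t| := by
  refine le_trans ?_ (exp_sub_sum_range_le_of_nonneg (abs_nonneg t) n)
  have h := Complex.norm_exp_sub_sum_le_exp_norm_sub_sum (t : ℂ) n
  rw [Complex.norm_real, Real.norm_eq_abs] at h
  rw [← Real.norm_eq_abs, ← Complex.norm_real]
  push_cast
  exact h

open Finset in
/-- Expansion of a centered correlation of indicators into joint probabilities. -/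
theorem integral_prod_indicator_sub {Ω ι : Type*} [MeasurableSpace Ω] [Fintype ι] [DecidableEq ι]
    (P : Measure Ω) [IsFiniteMeasure P] {A : ι → Set Ω} (hA : ∀ i, MeasurableSet (A i))
    (p : ι → ℝ) :
    ∫ ω, ∏ i, ((A i).indicator (fun _ => (1 : ℝ)) ω - p i) ∂P
      = ∑ I : Finset ι, (-1) ^ #Iᶜ * (∏ i ∈ Iᶜ, p i) * P.real (⋂ i ∈ I, A i) := by
  have hmeas (I : Finset ι) : MeasurableSet (⋂ i ∈ I, A i) :=
    I.measurableSet_biInter fun i _ => hA i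
  have h (ω : Ω) : ∏ i, ((A i).indicator (fun _ => (1 : ℝ)) ω - p i)
      = ∑ I : Finset ι, (-1) ^ #Iᶜ * (∏ i ∈ Iᶜ, p i) *
        (⋂ i ∈ I, A i).indicator (fun _ => (1 : ℝ)) ω := by
    simp_rw [sub_eq_add_neg]
    rw [prod_add, powerset_univ]
    refine sum_congr rfl fun I _ => ?_
    rw [prod_indicator_apply, ← compl_eq_univ_sdiff, prod_neg, mul_comm]
    simp [Set.indicator]
  simp_rw [h]
  rw [integral_finsetSum]
  · refine sum_congr rfl fun I _ => ?_
    rw [integral_const_mul, integral_indicator_const _ (hmeas I), smul_eq_mul, mul_one]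
  · exact fun I _ => ((integrable_const 1).indicator (hmeas I)).const_mul _

open Finset in
/-- Inclusion-exclusion with the singletons split off. -/
theorem sum_measureReal_sub_measureReal_biUnion {S ι : Type*} [MeasurableSpace S]
    [DecidableEq ι] {ν : Measure S} {E : ι → Set S} (hE : ∀ i, MeasurableSet (E i))
    (hfin : ∀ i, ν (E i) ≠ ⊤) (I : Finset ι) :
    ∑ i ∈ I, ν.real (E i) - ν.real (⋃ i ∈ I, E i)
      = ∑ J ∈ I.powerset with 2 ≤ #J, (-1) ^ #J * ν.real (⋂ i ∈ J, E i) := by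
  rw [measureReal_biUnion_eq_sum_powerset (fun i _ => hE i) (fun i _ => hfin i)]
  have hsplit : {J ∈ I.powerset | J.Nonempty}
      = powersetCard 1 I ∪ {J ∈ I.powerset | 2 ≤ #J} := by
    ext J
    simp only [mem_filter, mem_powerset, mem_union, mem_powersetCard, ← card_pos]
    have : 0 < #J ↔ #J = 1 ∨ 2 ≤ #J := by omega
    tauto
  have hdisj : Disjoint (powersetCard 1 I) {J ∈ I.powerset | 2 ≤ #J} := by
    rw [disjoint_left]
    intro J hJ hJ'
    have := (mem_powersetCard.1 hJ).2
    have := (mem_filter.1 hJ').2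
    omega
  rw [hsplit, sum_union hdisj, powersetCard_one, sum_map]
  simp [pow_succ]

open Finset in
/-- The truncated exponential series of the sums over subsets of `I`, summed over `I` with signs,
retains exactly the tuples covering everything. -/
theorem sum_neg_one_pow_mul_sum_pow {ι : Type*} [Fintype ι] [DecidableEq ι]
    (Q : Finset ι → Prop) [DecidablePred Q] (f : Finset ι → ℝ) (n : ℕ) :
    ∑ I : Finset ι, (-1) ^ #Iᶜ * (∑ J ∈ I.powerset with Q J, f J) ^ n
      = ∑ Js : Fin n → Finset ι with (∀ j, Q (Js j)) ∧ univ.biUnion Js = univ, ∏ j, f (Js j) := by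
  have h (I : Finset ι) : (∑ J ∈ I.powerset with Q J, f J) ^ n
      = ∑ Js : Fin n → Finset ι with ∀ j, Q (Js j),
          if univ.biUnion Js ⊆ I then ∏ j, f (Js j) else 0 := by
    rw [sum_pow', ← sum_filter, filter_filter]
    refine sum_congr ?_ fun _ _ => rfl
    ext Js
    simp [Fintype.mem_piFinset, forall_and, and_comm]
  simp_rw [h, mul_sum]
  rw [sum_comm, ← filter_filter, sum_filter (fun Js => univ.biUnion Js = univ)]
  refine sum_congr rfl fun Js _ => ?_
  have h' := congrArg (· * ∏ j, f (Js j))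
    (sum_neg_one_pow_card_compl_of_subset (univ.biUnion Js))
  simp only [sum_mul, ite_mul, one_mul, zero_mul] at h'
  simpa only [mul_ite, mul_zero] using h'

/-- Intersections of at least two of the `E i` have measure at most the largest pairwise one. -/
theorem measureReal_biInter_le_iSup {S : Type*} [MeasurableSpace S] {ν : Measure S} {k : ℕ}
    {E : Fin k → Set S} (hfin : ∀ i, ν (E i) ≠ ⊤) {J : Finset (Fin k)} (hJ : 2 ≤ J.card) :
    ν.real (⋂ i ∈ J, E i)
      ≤ ⨆ i : Fin k, ⨆ j : Fin k, ⨆ _ : i < j, ν.real (E i ∩ E j) := by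
  obtain ⟨a, ha, b, hb, hab⟩ : ∃ a ∈ J, ∃ b ∈ J, a < b := by
    obtain ⟨a, ha, b, hb, hne⟩ := Finset.one_lt_card.1 hJ
    rcases hne.lt_or_gt with h | h
    exacts [⟨a, ha, b, hb, h⟩, ⟨b, hb, a, ha, h⟩]
  have hle : ν.real (⋂ i ∈ J, E i) ≤ ν.real (E a ∩ E b) :=
    measureReal_mono (Set.subset_inter (Set.biInter_subset_of_mem ha)
      (Set.biInter_subset_of_mem hb)) (measure_ne_top_of_subset Set.inter_subset_left (hfin a))
  refine hle.trans <| le_trans ?_ <| (le_ciSup (Set.finite_range _).bddAbove b).trans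
    (le_ciSup (f := fun i => ⨆ j : Fin k, ⨆ _ : i < j, ν.real (E i ∩ E j))
      (Set.finite_range _).bddAbove a)
  exact le_ciSup (f := fun _ : a < b => ν.real (E a ∩ E b)) (Set.finite_range _).bddAbove hab

/-- The correlation series term as a signed sum of powers. -/
theorem poisCorrTerm_eq_sum_pow {S : Type*} [MeasurableSpace S] (ν : Measure S) {k : ℕ}
    (E : Fin k → Set S) (n : ℕ) :
    poisCorrTerm ν E n = ∑ I : Finset (Fin k), (-1) ^ Iᶜ.card *
      ((∑ J ∈ I.powerset with 2 ≤ J.card, (-1) ^ J.card * ν.real (⋂ i ∈ J, E i)) ^ n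
        / n.factorial) := by
  simp_rw [← mul_div_assoc, ← Finset.sum_div]
  rw [sum_neg_one_pow_mul_sum_pow (fun J : Finset (Fin k) => 2 ≤ J.card), poisCorrTerm,
    one_div, inv_mul_eq_div]
  simp only [Finset.prod_mul_distrib, Finset.prod_pow_eq_pow_sum, Measure.real]

theorem poisCorrTerm_zero {S : Type*} [MeasurableSpace S] (ν : Measure S) {k : ℕ} (hk : 0 < k)
    (E : Fin k → Set S) : poisCorrTerm ν E 0 = 0 := by
  have : Nonempty (Fin k) := ⟨⟨0, hk⟩⟩
  simp [poisCorrTerm, Finset.univ_eq_empty, Finset.univ_nonempty.ne_empty.symm]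

/-- Quantitative (truncated) correlation formula for Poisson vacancy events: with
`x = 2^k · max_{i<j} ν(E_i ∩ E_j)`, the error after truncating the correlation series
at order `M` is at most `e^{−∑_i ν(E_i)} · 2^k · x^{M+1}/(M+1)! · e^x`. -/
theorem poisson_vacancy_correlation_truncated
    {Ω : Type*} [MeasurableSpace Ω] (P : Measure Ω) [IsProbabilityMeasure P]
    {S : Type*} [MeasurableSpace S] (ν : Measure S)
    (k : ℕ) (hk : 2 ≤ k) (E : Fin k → Set S) (hE_meas : ∀ i, MeasurableSet (E i))
    (hE_fin : ∀ i, ν (E i) < ⊤)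
    (A : Fin k → Set Ω) (hA_meas : ∀ i, MeasurableSet (A i))
    (hP : ∀ I : Finset (Fin k),
      (P (⋂ i ∈ I, A i)).toReal = Real.exp (-(ν (⋃ i ∈ I, E i)).toReal))
    (x : ℝ)
    (hx : x = (2 : ℝ) ^ k * ⨆ i : Fin k, ⨆ j : Fin k, ⨆ _ : i < j,
      (ν (E i ∩ E j)).toReal) :
    ∀ M : ℕ,
      |(∫ ω, ∏ i : Fin k, ((A i).indicator (fun _ => (1 : ℝ)) ω - (P (A i)).toReal) ∂P)
          - Real.exp (-(∑ i : Fin k, (ν (E i)).toReal))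
              * ∑ n ∈ Finset.Icc 1 M, poisCorrTerm ν E n|
        ≤ Real.exp (-(∑ i : Fin k, (ν (E i)).toReal))
            * ((2 : ℝ) ^ k * x ^ (M + 1) / ((M + 1).factorial : ℝ) * Real.exp x) := by
  intro M
  have hfin (i : Fin k) : ν (E i) ≠ ⊤ := (hE_fin i).ne
  set s : Finset (Fin k) → ℝ := fun I =>
    ∑ J ∈ I.powerset with 2 ≤ J.card, (-1) ^ J.card * ν.real (⋂ i ∈ J, E i)
  have hprob (i : Fin k) : (P (A i)).toReal = Real.exp (-ν.real (E i)) := by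
    simpa [Measure.real] using hP {i}
  have hint : ∫ ω, ∏ i : Fin k, ((A i).indicator (fun _ => (1 : ℝ)) ω - (P (A i)).toReal) ∂P
      = Real.exp (-(∑ i : Fin k, (ν (E i)).toReal)) *
        ∑ I : Finset (Fin k), (-1) ^ Iᶜ.card * Real.exp (s I) := by
    rw [integral_prod_indicator_sub P hA_meas, Finset.mul_sum]
    refine Finset.sum_congr rfl fun I _ => ?_
    have hexp : (∏ i ∈ Iᶜ, (P (A i)).toReal) * P.real (⋂ i ∈ I, A i)
        = Real.exp (-(∑ i : Fin k, (ν (E i)).toReal)) * Real.exp (s I) := by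
      simp_rw [hprob]
      rw [Measure.real, hP I, ← Real.exp_sum, ← Real.exp_add, ← Real.exp_add, show s I = _ from
        (sum_measureReal_sub_measureReal_biUnion hE_meas hfin I).symm, ← Finset.sum_add_sum_compl I, Finset.sum_neg_distrib]
      simp only [Measure.real]
      ring_nf
    rw [mul_assoc, hexp]
    ring
  have hseries : ∑ n ∈ Finset.Icc 1 M, poisCorrTerm ν E n
      = ∑ I : Finset (Fin k), (-1) ^ Iᶜ.card *
        ∑ n ∈ Finset.range (M + 1), s I ^ n / n.factorial := by
    have h0 : ∑ n ∈ Finset.Icc 1 M, poisCorrTerm ν E n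
        = ∑ n ∈ Finset.range (M + 1), poisCorrTerm ν E n := by
      rw [Finset.sum_range_succ', poisCorrTerm_zero ν (by omega), add_zero,
        Finset.range_eq_Ico, Finset.sum_Ico_add' (poisCorrTerm ν E) 0 M 1]
      rfl
    simp_rw [h0, poisCorrTerm_eq_sum_pow, Finset.mul_sum]
    exact Finset.sum_comm
  have hsx (I : Finset (Fin k)) : |s I| ≤ x := by
    have hm : 0 ≤ ⨆ i : Fin k, ⨆ j : Fin k, ⨆ _ : i < j, ν.real (E i ∩ E j) :=
      Real.iSup_nonneg fun _ => Real.iSup_nonneg fun _ => Real.iSup_nonneg fun _ =>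
        measureReal_nonneg
    calc |s I| ≤ ∑ J ∈ I.powerset with 2 ≤ J.card,
          |(-1) ^ J.card * ν.real (⋂ i ∈ J, E i)| := Finset.abs_sum_le_sum_abs _ _
      _ ≤ ∑ J ∈ I.powerset with 2 ≤ J.card,
          ⨆ i : Fin k, ⨆ j : Fin k, ⨆ _ : i < j, ν.real (E i ∩ E j) := by
        refine Finset.sum_le_sum fun J hJ => ?_
        rw [abs_mul, abs_pow, abs_neg, abs_one, one_pow, one_mul, abs_of_nonneg measureReal_nonneg]
        exact measureReal_biInter_le_iSup hfin (Finset.mem_filter.1 hJ).2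
      _ ≤ ∑ _J : Finset (Fin k),
          ⨆ i : Fin k, ⨆ j : Fin k, ⨆ _ : i < j, ν.real (E i ∩ E j) :=
        Finset.sum_le_sum_of_subset_of_nonneg (Finset.subset_univ _) fun _ _ _ => hm
      _ = x := by simp [hx, Measure.real]
  rw [hint, hseries, ← mul_sub, abs_mul, abs_of_pos (Real.exp_pos _), ← Finset.sum_sub_distrib]
  refine mul_le_mul_of_nonneg_left ?_ (Real.exp_pos _).le
  calc |∑ I : Finset (Fin k), ((-1) ^ Iᶜ.card * Real.exp (s I)
        - (-1) ^ Iᶜ.card * ∑ n ∈ Finset.range (M + 1), s I ^ n / n.factorial)|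
      ≤ ∑ I : Finset (Fin k), |(-1) ^ Iᶜ.card * Real.exp (s I)
        - (-1) ^ Iᶜ.card * ∑ n ∈ Finset.range (M + 1), s I ^ n / n.factorial| :=
        Finset.abs_sum_le_sum_abs _ _
    _ ≤ ∑ _I : Finset (Fin k), x ^ (M + 1) / ((M + 1).factorial : ℝ) * Real.exp x := by
        refine Finset.sum_le_sum fun I _ => ?_
        rw [← mul_sub, abs_mul, abs_pow, abs_neg, abs_one, one_pow, one_mul]
        refine (abs_exp_sub_sum_range_le (s I) (M + 1)).trans ?_
        have := hsx I
        have hx0 : 0 ≤ x := (abs_nonneg _).trans this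
        gcongr
    _ = (2 : ℝ) ^ k * x ^ (M + 1) / ((M + 1).factorial : ℝ) * Real.exp x := by
        simp
        ring
end
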